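/- arXiv:1205.3004 — 2 statements merged into one kernel-verified Lean document; each statement's English description precedes it below -/
import Mathlib

section
/- Let u be a unit vector in R^d and A, B convex bodies with μ_{d-1}(π_u A) = μ_{d-1}(π_u B) = 1, and α, β > 0 with α + β = 1. Then μ_d(αA + βB) = α μ_d(A) + β μ_d(B) if and only if there exist translates A' and B' of a common convex body such that A and B are obtained from A' and B' respectively by stretching along u. -/
open MeasureTheory Pointwise
open scoped RealInnerProductSpace

/-- `K` is obtained from `C` by stretching along the unit vector `v`:
`K = C + [w, w + λv]` for some `λ ≥ 0` and `w`. -/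
def StretchOf {d : ℕ} (K C : Set (EuclideanSpace ℝ (Fin d)))
    (v : EuclideanSpace ℝ (Fin d)) : Prop :=
  ∃ lam : ℝ, 0 ≤ lam ∧ ∃ w : EuclideanSpace ℝ (Fin d),
    K = C + segment ℝ w (w + lam • v)

section BonnesenProjections

open Set Filter Topology
open scoped ENNReal

/-- The layer-cake formula for `ℝ≥0∞`-valued functions. -/
theorem lintegral_eq_lintegral_measure_ofReal_lt {X : Type*} [MeasurableSpace X]
    (μ : Measure X) [SFinite μ] {f : X → ℝ≥0∞} (hf : Measurable f) :
    ∫⁻ x, f x ∂μ = ∫⁻ t in Ioi (0 : ℝ), μ {x | ENNReal.ofReal t < f x} := by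
  have hS : MeasurableSet {p : X × ℝ | ENNReal.ofReal p.2 < f p.1} :=
    measurableSet_lt (by fun_prop) (by fun_prop)
  have key : ∀ y : ℝ≥0∞, volume.restrict (Ioi (0 : ℝ)) {t | ENNReal.ofReal t < y} = y := by
    intro y
    rw [Measure.restrict_apply (measurableSet_lt (by fun_prop) (by fun_prop))]
    rcases eq_or_ne y ⊤ with rfl | hy
    · simp
    · have : {t | ENNReal.ofReal t < y} ∩ Ioi 0 = Ioo 0 y.toReal := by
        ext t
        simp only [mem_inter_iff, mem_ofPred_eq, mem_Ioi, mem_Ioo]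
        constructor
        · rintro ⟨h, h0⟩
          exact ⟨h0, (ENNReal.ofReal_lt_iff_lt_toReal h0.le hy).1 h⟩
        · rintro ⟨h0, h⟩
          exact ⟨(ENNReal.ofReal_lt_iff_lt_toReal h0.le hy).2 h, h0⟩
      rw [this, Real.volume_Ioo, sub_zero, ENNReal.ofReal_toReal hy]
  have h1 := Measure.prod_apply (μ := μ) (ν := volume.restrict (Ioi (0 : ℝ))) hS
  have h2 := Measure.prod_apply_symm (μ := μ) (ν := volume.restrict (Ioi (0 : ℝ))) hS
  rw [h1] at h2
  exact (lintegral_congr fun x => (key (f x)).symm).trans h2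

theorem Real.volume_add_le_of_isCompact {A B C : Set ℝ} (hA : IsCompact A) (hB : IsCompact B)
    (hA' : A.Nonempty) (hB' : B.Nonempty) (h : A + B ⊆ C) :
    volume A + volume B ≤ volume C := by
  obtain ⟨a, ha, hamax⟩ := hA.exists_isGreatest hA'
  obtain ⟨b, hb, hbmin⟩ := hB.exists_isLeast hB'
  have h1 : volume (b +ᵥ A) = volume A := measure_vadd volume b A
  have h2 : volume (a +ᵥ B) = volume B := measure_vadd volume a B
  have hdisj : AEDisjoint volume (b +ᵥ A) (a +ᵥ B) := by
    refine measure_mono_null (t := {a + b}) ?_ (by simp)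
    rintro x ⟨⟨y, hy, rfl⟩, ⟨z, hz, hzy⟩⟩
    have := hamax hy
    have := hbmin hz
    simp only [vadd_eq_add, mem_singleton_iff] at hzy ⊢
    linarith
  rw [← h1, ← h2, ← measure_union₀ (hB.vadd a).measurableSet.nullMeasurableSet hdisj]
  refine measure_mono (union_subset ?_ ?_ |>.trans h)
  · rintro _ ⟨y, hy, rfl⟩
    exact ⟨y, hy, b, hb, by simp [add_comm]⟩
  · rintro _ ⟨y, hy, rfl⟩
    exact ⟨a, ha, y, hy, by simp⟩

/-- The Brunn–Minkowski inequality on the line. -/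
theorem Real.volume_add_le {A B C : Set ℝ} (hA : MeasurableSet A) (hB : MeasurableSet B)
    (hA' : A.Nonempty) (hB' : B.Nonempty) (h : A + B ⊆ C) :
    volume A + volume B ≤ volume C := by
  have approx : ∀ {D : Set ℝ}, MeasurableSet D → D.Nonempty → ∀ r < volume D,
      ∃ K ⊆ D, IsCompact K ∧ K.Nonempty ∧ r < volume K := by
    intro D hD _ r hr
    obtain ⟨K, hKD, hK, hrK⟩ := hD.exists_lt_isCompact hr
    exact ⟨K, hKD, hK, nonempty_of_measure_ne_zero (pos_of_gt hrK).ne', hrK⟩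
  have approx' : ∀ {D : Set ℝ}, MeasurableSet D → D.Nonempty →
      volume D = ⨆ K : {K : Set ℝ // K ⊆ D ∧ IsCompact K ∧ K.Nonempty}, volume K.1 := by
    intro D hD hD'
    refine le_antisymm (le_of_forall_lt fun r hr => ?_) (iSup_le fun K => measure_mono K.2.1)
    obtain ⟨K, hKD, hK, hKn, hrK⟩ := approx hD hD' r hr
    exact hrK.trans_le (le_iSup (fun K : {K : Set ℝ // K ⊆ D ∧ IsCompact K ∧ K.Nonempty} =>
      volume K.1) ⟨K, hKD, hK, hKn⟩)
  have inst : ∀ {D : Set ℝ}, D.Nonempty →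
      Nonempty {K : Set ℝ // K ⊆ D ∧ IsCompact K ∧ K.Nonempty} := fun ⟨x, hx⟩ =>
    ⟨⟨{x}, by simpa using hx, isCompact_singleton, by simp⟩⟩
  have := inst hA'
  have := inst hB'
  rw [approx' hA hA', approx' hB hB']
  exact ENNReal.iSup_add_iSup_le fun K L => Real.volume_add_le_of_isCompact K.2.2.1 L.2.2.1
    K.2.2.2 L.2.2.2 ((add_subset_add K.2.1 L.2.1).trans h)

theorem Real.volume_smul_add_smul_le {A B C : Set ℝ} {α β : ℝ} (hα : 0 < α) (hβ : 0 < β)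
    (hA : MeasurableSet A) (hB : MeasurableSet B)
    (hA' : A.Nonempty) (hB' : B.Nonempty) (h : α • A + β • B ⊆ C) :
    ENNReal.ofReal α * volume A + ENNReal.ofReal β * volume B ≤ volume C := by
  have := Real.volume_add_le (hA.const_smul₀ α) (hB.const_smul₀ β) hA'.smul_set hB'.smul_set h
  simpa [Measure.addHaar_smul, abs_of_pos hα, abs_of_pos hβ] using this

/-- If two functions on the line have the same supremum, then the integral of any function that
dominates their min-convolution is at least the corresponding average of their integrals. -/
theorem Real.lintegral_add_le_of_min_le {α β : ℝ} (hα : 0 < α) (hβ : 0 < β) {f g h : ℝ → ℝ≥0∞}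
    (hf : Measurable f) (hg : Measurable g) (hh : Measurable h) {M : ℝ≥0∞}
    (hfM : ∀ s, f s ≤ M) (hgM : ∀ s, g s ≤ M) (hf' : ∀ v < M, ∃ s, v < f s)
    (hg' : ∀ v < M, ∃ s, v < g s) (H : ∀ s t, min (f s) (g t) ≤ h (α * s + β * t)) :
    ENNReal.ofReal α * (∫⁻ s, f s) + ENNReal.ofReal β * (∫⁻ s, g s) ≤ ∫⁻ s, h s := by
  rw [lintegral_eq_lintegral_measure_ofReal_lt _ hf, lintegral_eq_lintegral_measure_ofReal_lt _ hg,
    lintegral_eq_lintegral_measure_ofReal_lt _ hh]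
  have meas : ∀ {k : ℝ → ℝ≥0∞}, Measurable k → Measurable fun t : ℝ =>
      volume {x | ENNReal.ofReal t < k x} := fun {k} hk =>
    measurable_measure_prodMk_left (ν := (volume : Measure ℝ))
      (s := {p : ℝ × ℝ | ENNReal.ofReal p.1 < k p.2})
      (measurableSet_lt (by fun_prop) (by fun_prop))
  rw [← lintegral_const_mul _ (meas hf), ← lintegral_const_mul _ (meas hg),
    ← lintegral_add_left ((meas hf).const_mul _)]
  refine lintegral_mono fun t => ?_
  by_cases ht : ENNReal.ofReal t < M
  · refine Real.volume_smul_add_smul_le hα hβ (measurableSet_lt (by fun_prop) (by fun_prop))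
      (measurableSet_lt (by fun_prop) (by fun_prop)) (hf' _ ht) (hg' _ ht) ?_
    rintro _ ⟨_, ⟨s, hs, rfl⟩, _, ⟨r, hr, rfl⟩, rfl⟩
    exact (lt_min hs hr).trans_le (H s r)
  · have h1 : {x | ENNReal.ofReal t < f x} = ∅ := by
      ext x; simpa using (hfM x).trans (not_lt.1 ht)
    have h2 : {x | ENNReal.ofReal t < g x} = ∅ := by
      ext x; simpa using (hgM x).trans (not_lt.1 ht)
    simp [h1, h2]

/-- The Prékopa–Leindler inequality for the measure `μ`. -/
def PrekopaLeindler {X : Type*} [AddCommGroup X] [Module ℝ X] [MeasurableSpace X]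
    (μ : Measure X) : Prop :=
  ∀ ⦃α β : ℝ⦄, 0 < α → 0 < β → α + β = 1 → ∀ ⦃f g h : X → ℝ≥0∞⦄,
    Measurable f → Measurable g → Measurable h →
    (∀ x y, f x ^ α * g y ^ β ≤ h (α • x + β • y)) →
    (∫⁻ x, f x ∂μ) ^ α * (∫⁻ x, g x ∂μ) ^ β ≤ ∫⁻ x, h x ∂μ

theorem ENNReal.rpow_mul_rpow_le_add {α β : ℝ} (hα : 0 < α) (hβ : 0 < β) (hαβ : α + β = 1)
    (x y : ℝ≥0∞) : x ^ α * y ^ β ≤ ENNReal.ofReal α * x + ENNReal.ofReal β * y := by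
  have hα0 : ENNReal.ofReal α ≠ 0 := by simpa using hα
  have hβ0 : ENNReal.ofReal β ≠ 0 := by simpa using hβ
  rcases eq_or_ne x ⊤ with rfl | hx
  · simp [ENNReal.mul_top hα0]
  rcases eq_or_ne y ⊤ with rfl | hy
  · simp [ENNReal.mul_top hβ0]
  lift x to NNReal using hx
  lift y to NNReal using hy
  have := NNReal.geom_mean_le_arith_mean2_weighted α.toNNReal β.toNNReal x y
    (by rw [← Real.toNNReal_add hα.le hβ.le, hαβ, Real.toNNReal_one])
  rw [Real.coe_toNNReal _ hα.le, Real.coe_toNNReal _ hβ.le] at this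
  rw [← ENNReal.coe_rpow_of_nonneg _ hα.le, ← ENNReal.coe_rpow_of_nonneg _ hβ.le]
  simp only [ENNReal.ofReal]
  exact_mod_cast this

theorem Real.prekopaLeindler_of_iSup_ne_top {α β : ℝ} (hα : 0 < α) (hβ : 0 < β)
    (hαβ : α + β = 1) {f g h : ℝ → ℝ≥0∞}
    (hf : Measurable f) (hg : Measurable g) (hh : Measurable h)
    (hfM : ⨆ s, f s ≠ ⊤) (hgM : ⨆ s, g s ≠ ⊤)
    (H : ∀ s t, f s ^ α * g t ^ β ≤ h (α * s + β * t)) :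
    (∫⁻ s, f s) ^ α * (∫⁻ s, g s) ^ β ≤ ∫⁻ s, h s := by
  set F := ⨆ s, f s with hF
  set G := ⨆ s, g s with hG
  rcases eq_or_ne F 0 with hF0 | hF0
  · have : ∀ s, f s = 0 := fun s => le_antisymm ((le_iSup f s).trans hF0.le) bot_le
    simp [this, ENNReal.zero_rpow_of_pos hα]
  rcases eq_or_ne G 0 with hG0 | hG0
  · have : ∀ s, g s = 0 := fun s => le_antisymm ((le_iSup g s).trans hG0.le) bot_le
    simp [this, ENNReal.zero_rpow_of_pos hβ]
  have norm_le : ∀ {k : ℝ → ℝ≥0∞} (s), (⨆ s, k s) ≠ 0 → (⨆ s, k s) ≠ ⊤ →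
      (⨆ s, k s)⁻¹ * k s ≤ 1 := fun {k} s h0 hT => by
    calc _ ≤ (⨆ s, k s)⁻¹ * ⨆ s, k s := by gcongr; exact le_iSup k s
      _ = 1 := ENNReal.inv_mul_cancel h0 hT
  have norm_lt : ∀ {k : ℝ → ℝ≥0∞}, (⨆ s, k s) ≠ 0 → (⨆ s, k s) ≠ ⊤ → ∀ v < 1,
      ∃ s, v < (⨆ s, k s)⁻¹ * k s := fun {k} h0 hT v hv => by
    have : v * (⨆ s, k s) < ⨆ s, k s := by
      simpa using ENNReal.mul_lt_mul_left h0 hT hv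
    obtain ⟨s, hs⟩ := lt_iSup_iff.1 this
    refine ⟨s, ?_⟩
    rw [← ENNReal.div_eq_inv_mul]
    exact (ENNReal.lt_div_iff_mul_lt (Or.inl h0) (Or.inl hT)).2 hs
  have hFG0 : F ^ α * G ^ β ≠ 0 :=
    mul_ne_zero (by simp [hF0, hα.le, hα]) (by simp [hG0, hβ.le, hβ])
  have hFGT : F ^ α * G ^ β ≠ ⊤ :=
    ENNReal.mul_ne_top (ENNReal.rpow_ne_top_of_nonneg hα.le hfM)
      (ENNReal.rpow_ne_top_of_nonneg hβ.le hgM)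
  have split : ∀ x y : ℝ≥0∞, (F⁻¹ * x) ^ α * (G⁻¹ * y) ^ β =
      (F ^ α * G ^ β)⁻¹ * (x ^ α * y ^ β) := fun x y => by
    rw [ENNReal.mul_rpow_of_nonneg _ _ hα.le, ENNReal.mul_rpow_of_nonneg _ _ hβ.le,
      ENNReal.inv_rpow, ENNReal.inv_rpow, ENNReal.mul_inv (Or.inl (by simp [hF0, hα.le, hα]))
        (Or.inr (by simp [hG0, hβ.le, hβ]))]
    ring
  have key := Real.lintegral_add_le_of_min_le hα hβ (hf.const_mul F⁻¹) (hg.const_mul G⁻¹)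
    (hh.const_mul (F ^ α * G ^ β)⁻¹) (M := 1) (fun s => norm_le s hF0 hfM)
    (fun s => norm_le s hG0 hgM) (norm_lt hF0 hfM) (norm_lt hG0 hgM) (fun s t => ?_)
  · rw [lintegral_const_mul _ hf, lintegral_const_mul _ hg, lintegral_const_mul _ hh] at key
    have := (ENNReal.rpow_mul_rpow_le_add hα hβ hαβ _ _).trans key
    rw [split] at this
    exact (ENNReal.mul_le_mul_iff_right (ENNReal.inv_ne_zero.2 hFGT)
      (ENNReal.inv_ne_top.2 hFG0)).1 this
  · refine le_trans ?_ (mul_le_mul_right (H s t) (F ^ α * G ^ β)⁻¹)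
    rw [← split]
    set m := min (F⁻¹ * f s) (G⁻¹ * g t)
    calc m = m ^ α * m ^ β := by
          rw [← ENNReal.rpow_add_of_nonneg _ _ hα.le hβ.le, hαβ, ENNReal.rpow_one]
      _ ≤ _ := by
          gcongr
          · exact min_le_left _ _
          · exact min_le_right _ _

theorem Real.prekopaLeindler_volume : PrekopaLeindler (volume : Measure ℝ) := by
  intro α β hα hβ hαβ f g h hf hg hh H
  have trunc : ∀ {k : ℝ → ℝ≥0∞}, Measurable k →
      Tendsto (fun n : ℕ => ∫⁻ s, min (k s) n) atTop (𝓝 (∫⁻ s, k s)) := fun {k} hk => by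
    refine lintegral_tendsto_of_tendsto_of_monotone (fun n => by fun_prop)
      (ae_of_all _ fun s m n hmn => ?_) (ae_of_all _ fun s => ?_)
    · dsimp only; gcongr
    · simpa using tendsto_const_nhds.min ENNReal.tendsto_nat_nhds_top
  have bdd : ∀ (k : ℝ → ℝ≥0∞) (n : ℕ), ⨆ s, min (k s) n ≠ ⊤ := fun k n =>
    ((iSup_le fun s => min_le_right _ _).trans_lt (ENNReal.natCast_lt_top n)).ne
  rcases eq_or_ne (∫⁻ s, f s) 0 with hf0 | hf0
  · simp [hf0, ENNReal.zero_rpow_of_pos hα]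
  rcases eq_or_ne (∫⁻ s, g s) 0 with hg0 | hg0
  · simp [hg0, ENNReal.zero_rpow_of_pos hβ]
  refine le_of_tendsto (ENNReal.Tendsto.mul ((trunc hf).ennrpow_const α)
    (Or.inl (by simp [hf0, hα.le, hα])) ((trunc hg).ennrpow_const β)
    (Or.inl (by simp [hg0, hβ.le, hβ]))) (Eventually.of_forall fun n => ?_)
  refine Real.prekopaLeindler_of_iSup_ne_top hα hβ hαβ (by fun_prop) (by fun_prop) hh
    (bdd f n) (bdd g n) fun s t => le_trans ?_ (H s t)
  gcongr
  · exact min_le_left _ _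
  · exact min_le_left _ _

theorem PrekopaLeindler.prod {X Y : Type*} [AddCommGroup X] [Module ℝ X] [MeasurableSpace X]
    [AddCommGroup Y] [Module ℝ Y] [MeasurableSpace Y] {μ : Measure X} {ν : Measure Y}
    [SFinite μ] [SFinite ν] (hμ : PrekopaLeindler μ) (hν : PrekopaLeindler ν) :
    PrekopaLeindler (μ.prod ν) := by
  intro α β hα hβ hαβ f g h hf hg hh H
  rw [lintegral_prod _ hf.aemeasurable, lintegral_prod _ hg.aemeasurable,
    lintegral_prod _ hh.aemeasurable]
  refine hμ hα hβ hαβ hf.lintegral_prod_right' hg.lintegral_prod_right' hh.lintegral_prod_right'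
    fun x y => hν hα hβ hαβ (by fun_prop) (by fun_prop) (by fun_prop) fun a b => H (x, a) (y, b)

theorem PrekopaLeindler.of_measurePreserving {X Y : Type*} [AddCommGroup X] [Module ℝ X]
    [MeasurableSpace X] [AddCommGroup Y] [Module ℝ Y] [MeasurableSpace Y] {μ : Measure X}
    {ν : Measure Y} (hμ : PrekopaLeindler μ) (e : X →ₗ[ℝ] Y) (he : MeasurePreserving e μ ν) :
    PrekopaLeindler ν := by
  intro α β hα hβ hαβ f g h hf hg hh H
  rw [← he.lintegral_comp hf, ← he.lintegral_comp hg, ← he.lintegral_comp hh]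
  refine hμ hα hβ hαβ (hf.comp he.measurable) (hg.comp he.measurable) (hh.comp he.measurable)
    fun x y => ?_
  simpa using H (e x) (e y)

theorem prekopaLeindler_volume_pi (n : ℕ) :
    PrekopaLeindler (volume : Measure (Fin n → ℝ)) := by
  induction n with
  | zero =>
    intro α β hα hβ hαβ f g h hf hg hh H
    have hvol : (volume : Measure (Fin 0 → ℝ)) univ = 1 := by simp [volume_pi]
    simp only [lintegral_unique, hvol, mul_one]
    convert H default default
  | succ n ih =>
    have e : ⇑(Fin.consLinearEquiv ℝ fun _ : Fin (n + 1) => ℝ).toLinearMap =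
        (MeasurableEquiv.piFinSuccAbove (fun _ : Fin (n + 1) => ℝ) 0).symm := by
      funext p
      refine funext fun i => Fin.cases ?_ (fun i => ?_) i <;> simp [MeasurableEquiv.piFinSuccAbove]
    refine (Real.prekopaLeindler_volume.prod ih).of_measurePreserving
      (Fin.consLinearEquiv ℝ fun _ : Fin (n + 1) => ℝ).toLinearMap ?_
    rw [e]
    exact (volume_preserving_piFinSuccAbove (fun _ : Fin (n + 1) => ℝ) 0).symm

theorem PrekopaLeindler.measure_rpow_mul_le {X : Type*} [AddCommGroup X] [Module ℝ X]
    [MeasurableSpace X] {μ : Measure X} (hμ : PrekopaLeindler μ) {α β : ℝ} (hα : 0 < α)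
    (hβ : 0 < β) (hαβ : α + β = 1) {A B C : Set X} (hA : MeasurableSet A) (hB : MeasurableSet B)
    (hC : MeasurableSet C) (h : α • A + β • B ⊆ C) : μ A ^ α * μ B ^ β ≤ μ C := by
  rw [← lintegral_indicator_one hA, ← lintegral_indicator_one hB, ← lintegral_indicator_one hC]
  refine hμ hα hβ hαβ (measurable_one.indicator hA) (measurable_one.indicator hB)
    (measurable_one.indicator hC) fun x y => ?_
  by_cases hx : x ∈ A
  · by_cases hy : y ∈ B
    · have : α • x + β • y ∈ C := h (add_mem_add (smul_mem_smul_set hx) (smul_mem_smul_set hy))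
      simp [hx, hy, this]
    · simp [hy, ENNReal.zero_rpow_of_pos hβ]
  · simp [hx, ENNReal.zero_rpow_of_pos hα]

/-- `F` is a continuous monotone function increasing from `0` to `V` such that `F` and `V - F`
are log-concave, as is the distribution function of a log-concave measure of mass `V`. -/
structure IsLogConcaveCDF (F : ℝ → ℝ) (V : ℝ) : Prop where
  mono : Monotone F
  continuous : Continuous F
  tendsto_atBot : Tendsto F atBot (𝓝 0)
  tendsto_atTop : Tendsto F atTop (𝓝 V)
  concaveOn_log : ConcaveOn ℝ {s | 0 < F s} fun s => Real.log (F s)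
  concaveOn_log_sub : ConcaveOn ℝ {s | F s < V} fun s => Real.log (V - F s)

namespace IsLogConcaveCDF

variable {F G H : ℝ → ℝ} {V : ℝ}

theorem nonneg (hF : IsLogConcaveCDF F V) (s : ℝ) : 0 ≤ F s :=
  hF.mono.le_of_tendsto hF.tendsto_atBot s

theorem le (hF : IsLogConcaveCDF F V) (s : ℝ) : F s ≤ V :=
  hF.mono.ge_of_tendsto hF.tendsto_atTop s

theorem exists_eq (hF : IsLogConcaveCDF F V) {τ : ℝ} (h0 : 0 < τ) (hV : τ < V) :
    ∃ s, F s = τ := by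
  obtain ⟨a, ha⟩ := (hF.tendsto_atBot.eventually_lt_const h0).exists
  obtain ⟨b, hb⟩ := (hF.tendsto_atTop.eventually_const_lt hV).exists
  exact mem_range_of_exists_le_of_exists_ge hF.continuous ⟨a, ha.le⟩ ⟨b, hb.le⟩

theorem exists_hasDerivAt (hF : IsLogConcaveCDF F V) {s : ℝ} (h0 : 0 < F s) (hV : F s < V) :
    ∃ f, 0 < f ∧ HasDerivAt F f s := by
  have i0 : s ∈ interior {s | 0 < F s} := by
    rwa [(isOpen_lt continuous_const hF.continuous).interior_eq]
  have iV : s ∈ interior {s | F s < V} := by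
    rwa [(isOpen_lt hF.continuous continuous_const).interior_eq]
  have c0 := hF.concaveOn_log.neg
  have cV := hF.concaveOn_log_sub.neg
  have l0 := c0.hasDerivWithinAt_leftDeriv_of_mem_interior i0
  have r0 := c0.hasDerivWithinAt_rightDeriv_of_mem_interior i0
  have lV := cV.hasDerivWithinAt_leftDeriv_of_mem_interior iV
  have rV := cV.hasDerivWithinAt_rightDeriv_of_mem_interior iV
  have le0 := c0.leftDeriv_le_rightDeriv_of_mem_interior i0
  have leV := cV.leftDeriv_le_rightDeriv_of_mem_interior iV
  have hmin := c0.isMinOn_of_rightDeriv_eq_zero i0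
  set L0 := derivWithin (-fun s => Real.log (F s)) (Iio s) s
  set R0 := derivWithin (-fun s => Real.log (F s)) (Ioi s) s
  set LV := derivWithin (-fun s => Real.log (V - F s)) (Iio s) s
  set RV := derivWithin (-fun s => Real.log (V - F s)) (Ioi s) s
  have conv0 : ∀ {S : Set ℝ} {D : ℝ}, HasDerivWithinAt (-fun s => Real.log (F s)) D S s →
      HasDerivWithinAt F (F s * -D) S s := fun {S D} h => by
    have h' := h.neg.exp
    simp only [Pi.neg_apply, neg_neg, Real.exp_log h0] at h'
    refine (h'.congr_of_eventuallyEq ?_ (by simp [Real.exp_log h0]))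
    filter_upwards [mem_nhdsWithin_of_mem_nhds (mem_interior_iff_mem_nhds.1 i0)] with t ht
    simp [Real.exp_log (show 0 < F t from ht)]
  have hV' : 0 < V - F s := sub_pos.2 hV
  have convV : ∀ {S : Set ℝ} {D : ℝ}, HasDerivWithinAt (-fun s => Real.log (V - F s)) D S s →
      HasDerivWithinAt F ((V - F s) * D) S s := fun {S D} h => by
    have h' := (h.neg.exp).const_sub V
    simp only [Pi.neg_apply, neg_neg, Real.exp_log hV', mul_neg] at h'
    refine (h'.congr_of_eventuallyEq ?_ (by simp [Real.exp_log hV']))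
    filter_upwards [mem_nhdsWithin_of_mem_nhds (mem_interior_iff_mem_nhds.1 iV)] with t ht
    simp [Real.exp_log (show 0 < V - F t from sub_pos.2 ht)]
  have eL := (uniqueDiffWithinAt_Iio s).eq_deriv _ (conv0 l0) (convV lV)
  have eR := (uniqueDiffWithinAt_Ioi s).eq_deriv _ (conv0 r0) (convV rV)
  have hLR : L0 = R0 := by
    refine le_antisymm le0 ?_
    have : (V - F s) * LV ≤ (V - F s) * RV := by gcongr
    rw [← eL, ← eR] at this
    nlinarith
  have hder : HasDerivAt F (F s * -R0) s := by
    have := (hLR ▸ conv0 l0).union (conv0 r0)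
    rw [Iio_union_Ioi] at this
    rw [← hasDerivWithinAt_univ, ← hasDerivWithinAt_sdiff_singleton]
    simpa [compl_eq_univ_sdiff] using this
  refine ⟨_, lt_of_le_of_ne ?_ fun h => ?_, hder⟩
  · exact hder.deriv ▸ hF.mono.deriv_nonneg
  · have hR : R0 = 0 := by
      rcases mul_eq_zero.1 h.symm with h | h
      · exact absurd h h0.ne'
      · linarith
    obtain ⟨t, ht⟩ := (hF.tendsto_atTop.eventually_const_lt hV).exists
    have := hmin hR (h0.trans ht)
    simp only [mem_ofPred_eq, Pi.neg_apply, neg_le_neg_iff] at this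
    exact absurd (Real.log_lt_log h0 ht) (not_lt.2 this)

/-- The quantile function is differentiable. -/
theorem exists_quantile (hF : IsLogConcaveCDF F V) :
    ∃ q f : ℝ → ℝ, ∀ τ ∈ Ioo 0 V, F (q τ) = τ ∧ 0 < f τ ∧ HasDerivAt F (f τ) (q τ) ∧
      HasDerivAt q (f τ)⁻¹ τ := by
  have h : ∀ τ, ∃ s f, τ ∈ Ioo 0 V → F s = τ ∧ 0 < f ∧ HasDerivAt F f s := fun τ => by
    by_cases hτ : τ ∈ Ioo 0 V
    · obtain ⟨s, hs⟩ := hF.exists_eq hτ.1 hτ.2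
      obtain ⟨f, hf, hd⟩ := hF.exists_hasDerivAt (hs.symm ▸ hτ.1) (hs.symm ▸ hτ.2)
      exact ⟨s, f, fun _ => ⟨hs, hf, hd⟩⟩
    · exact ⟨0, 0, fun h => absurd h hτ⟩
  choose q f hqf using h
  refine ⟨q, f, fun τ hτ => ?_⟩
  obtain ⟨h1, h2, h3⟩ := hqf τ hτ
  refine ⟨h1, h2, h3, ?_⟩
  have hq : StrictMonoOn q (Ioo 0 V) := fun a ha b hb hab => by
    refine hF.mono.reflect_lt ?_
    rwa [(hqf a ha).1, (hqf b hb).1]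
  have hU : IsOpen {s | 0 < F s ∧ F s < V} :=
    (isOpen_lt continuous_const hF.continuous).inter (isOpen_lt hF.continuous continuous_const)
  have hstrict : StrictMonoOn F {s | 0 < F s ∧ F s < V} := by
    refine strictMonoOn_of_deriv_pos ?_ hF.continuous.continuousOn fun x hx => ?_
    · refine (OrdConnected.preimage_mono (s := Ioo 0 V) ?_ hF.mono).convex
      exact ordConnected_Ioo
    · rw [hU.interior_eq] at hx
      obtain ⟨g, hg, hd⟩ := hF.exists_hasDerivAt hx.1 hx.2
      rwa [hd.deriv]
  have hcont : ContinuousAt q τ := by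
    refine hq.continuousAt_of_image_mem_nhds (isOpen_Ioo.mem_nhds hτ) ?_
    refine mem_of_superset (hU.mem_nhds (x := q τ) (by simpa [h1] using hτ)) fun x hx => ?_
    refine ⟨F x, hx, hstrict.injOn (?_ : 0 < F _ ∧ F _ < V) hx (hqf _ hx).1⟩
    rw [(hqf _ hx).1]
    exact hx
  refine h3.of_local_left_inverse hcont h2.ne' ?_
  filter_upwards [isOpen_Ioo.mem_nhds hτ] with t ht using (hqf t ht).1

/-- If the distribution function `H` of a measure of mass `V` dominates `F` and `G` in the sense
of Brunn and Minkowski, then `F` and `G` agree up to a translation. -/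
theorem exists_eq_translate (hF : IsLogConcaveCDF F V) (hG : IsLogConcaveCDF G V)
    (hH : IsLogConcaveCDF H V) {α β : ℝ} (hα : 0 < α) (hβ : 0 < β)
    (hαβ : α + β = 1)
    (hle : ∀ s t, F s ^ α * G t ^ β ≤ H (α * s + β * t))
    (hle' : ∀ s t, (V - F s) ^ α * (V - G t) ^ β ≤ V - H (α * s + β * t))
    (hslab : ∀ s t δ, 0 < δ → (F (s + δ) - F s) ^ α * (G (t + δ) - G t) ^ β ≤
      H (α * s + β * t + δ) - H (α * s + β * t)) :
    ∃ c, ∀ s, F s = G (s - c) := by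
  obtain ⟨q₁, f, h₁⟩ := hF.exists_quantile
  obtain ⟨q₂, g, h₂⟩ := hG.exists_quantile
  have self : ∀ x : ℝ, 0 < x → x ^ α * x ^ β = x := fun x hx => by
    rw [← Real.rpow_add hx, hαβ, Real.rpow_one]
  have hHp : ∀ τ ∈ Ioo 0 V, H (α * q₁ τ + β * q₂ τ) = τ := fun τ hτ => by
    have e1 := hle (q₁ τ) (q₂ τ)
    have e2 := hle' (q₁ τ) (q₂ τ)
    rw [(h₁ τ hτ).1, (h₂ τ hτ).1, self _ hτ.1] at e1
    rw [(h₁ τ hτ).1, (h₂ τ hτ).1, self _ (sub_pos.2 hτ.2)] at e2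
    linarith
  have slope : ∀ {K : ℝ → ℝ} {k s : ℝ}, HasDerivAt K k s →
      Tendsto (fun δ => (K (s + δ) - K s) / δ) (𝓝[>] 0) (𝓝 k) := fun {K k s} hK => by
    have := hK.tendsto_slope_zero_right
    simpa [div_eq_inv_mul] using this
  have hfg : ∀ τ ∈ Ioo 0 V, f τ = g τ := fun τ hτ => by
    obtain ⟨-, f0, fd, q1d⟩ := h₁ τ hτ
    obtain ⟨-, g0, gd, q2d⟩ := h₂ τ hτ
    obtain ⟨k, -, hk⟩ := hH.exists_hasDerivAt (s := α * q₁ τ + β * q₂ τ)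
      (by rw [hHp τ hτ]; exact hτ.1) (by rw [hHp τ hτ]; exact hτ.2)
    have hprod : f τ ^ α * g τ ^ β ≤ k := by
      refine le_of_tendsto_of_tendsto (((slope fd).rpow_const (Or.inr hα.le)).mul
        ((slope gd).rpow_const (Or.inr hβ.le))) (slope hk) ?_
      filter_upwards [self_mem_nhdsWithin] with δ hδ
      have hδ' : 0 < δ := hδ
      have a1 : 0 ≤ F (q₁ τ + δ) - F (q₁ τ) := sub_nonneg.2 (hF.mono (by linarith))
      have a2 : 0 ≤ G (q₂ τ + δ) - G (q₂ τ) := sub_nonneg.2 (hG.mono (by linarith))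
      rw [Real.div_rpow a1 hδ'.le, Real.div_rpow a2 hδ'.le, div_mul_div_comm, self _ hδ']
      exact div_le_div_of_nonneg_right (hslab _ _ _ hδ') hδ'.le
    have hcomp : k * (α * (f τ)⁻¹ + β * (g τ)⁻¹) = 1 := by
      have d1 : HasDerivAt (fun t => H (α * q₁ t + β * q₂ t))
          (k * (α * (f τ)⁻¹ + β * (g τ)⁻¹)) τ :=
        HasDerivAt.comp τ hk ((q1d.const_mul α).add (q2d.const_mul β))
      have d2 : HasDerivAt (fun t => H (α * q₁ t + β * q₂ t)) 1 τ := by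
        refine (hasDerivAt_id τ).congr_of_eventuallyEq ?_
        filter_upwards [isOpen_Ioo.mem_nhds hτ] with t ht using hHp t ht
      exact d1.unique d2
    by_contra hne
    have hlt := (Real.geom_mean_lt_arith_mean2_weighted_iff_of_pos hα hβ (inv_pos.2 f0).le
      (inv_pos.2 g0).le hαβ).2 fun h => hne (inv_injective h)
    rw [Real.inv_rpow f0.le, Real.inv_rpow g0.le, ← mul_inv] at hlt
    have hpos : 0 < f τ ^ α * g τ ^ β := by positivity
    have : 1 < (f τ ^ α * g τ ^ β) * (α * (f τ)⁻¹ + β * (g τ)⁻¹) := by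
      calc 1 = (f τ ^ α * g τ ^ β) * (f τ ^ α * g τ ^ β)⁻¹ := (mul_inv_cancel₀ hpos.ne').symm
        _ < _ := by gcongr
    have h2 : (f τ ^ α * g τ ^ β) * (α * (f τ)⁻¹ + β * (g τ)⁻¹) ≤
        k * (α * (f τ)⁻¹ + β * (g τ)⁻¹) := by gcongr
    linarith
  obtain ⟨c, hc⟩ : ∃ c, ∀ τ ∈ Ioo 0 V, q₁ τ - q₂ τ = c := by
    have hd : ∀ τ ∈ Ioo 0 V, HasDerivAt (fun t => q₁ t - q₂ t) 0 τ := fun τ hτ => by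
      have := (h₁ τ hτ).2.2.2.sub (h₂ τ hτ).2.2.2
      rwa [hfg τ hτ, sub_self] at this
    exact isOpen_Ioo.exists_is_const_of_deriv_eq_zero isPreconnected_Ioo
      (fun τ hτ => (hd τ hτ).differentiableAt.differentiableWithinAt) fun τ hτ => (hd τ hτ).deriv
  refine ⟨c, fun s => le_antisymm (le_of_not_gt fun h => ?_) (le_of_not_gt fun h => ?_)⟩
  · obtain ⟨τ, h3, h4⟩ := exists_between h
    have hτ : τ ∈ Ioo 0 V := ⟨(hG.nonneg _).trans_lt h3, h4.trans_le (hF.le _)⟩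
    rw [← (h₁ τ hτ).1] at h4
    rw [← (h₂ τ hτ).1] at h3
    have := hF.mono.reflect_lt h4
    have := hG.mono.reflect_lt h3
    have := hc τ hτ
    linarith
  · obtain ⟨τ, h3, h4⟩ := exists_between h
    have hτ : τ ∈ Ioo 0 V := ⟨(hF.nonneg _).trans_lt h3, h4.trans_le (hG.le _)⟩
    rw [← (h₁ τ hτ).1] at h3
    rw [← (h₂ τ hτ).1] at h4
    have := hF.mono.reflect_lt h3
    have := hG.mono.reflect_lt h4
    have := hc τ hτ
    linarith

end IsLogConcaveCDF

section BrunnMinkowskiEquality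

variable {Y : Type*} [NormedAddCommGroup Y] [NormedSpace ℝ Y]

theorem smul_inter_preimage_add_subset {α β : ℝ} {K L : Set Y} {I J T : Set ℝ} (φ : Y →L[ℝ] ℝ)
    (h : ∀ s ∈ I, ∀ t ∈ J, α * s + β * t ∈ T) :
    α • (K ∩ φ ⁻¹' I) + β • (L ∩ φ ⁻¹' J) ⊆ (α • K + β • L) ∩ φ ⁻¹' T := by
  rintro _ ⟨_, ⟨x, hx, rfl⟩, _, ⟨y, hy, rfl⟩, rfl⟩
  refine ⟨add_mem_add (smul_mem_smul_set hx.1) (smul_mem_smul_set hy.1), ?_⟩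
  simpa using h _ hx.2 _ hy.2

variable [MeasurableSpace Y] {μ : Measure Y}

theorem PrekopaLeindler.measureReal_rpow_mul_le (hμ : PrekopaLeindler μ) {α β : ℝ} (hα : 0 < α)
    (hβ : 0 < β) (hαβ : α + β = 1) {A B C : Set Y} (hA : MeasurableSet A) (hB : MeasurableSet B)
    (hC : MeasurableSet C) (hCT : μ C ≠ ⊤) (h : α • A + β • B ⊆ C) :
    μ.real A ^ α * μ.real B ^ β ≤ μ.real C := by
  simp only [measureReal_def, ENNReal.toReal_rpow, ← ENNReal.toReal_mul]
  exact ENNReal.toReal_mono hCT (hμ.measure_rpow_mul_le hα hβ hαβ hA hB hC h)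

variable [BorelSpace Y]

theorem measureReal_inter_preimage_Ioi [IsFiniteMeasureOnCompacts μ] {K : Set Y}
    (hK : IsCompact K) (φ : Y →L[ℝ] ℝ) (s : ℝ) :
    μ.real (K ∩ φ ⁻¹' Ioi s) = μ.real K - μ.real (K ∩ φ ⁻¹' Iic s) := by
  have := measureReal_inter_add_sdiff (μ := μ) (s := K)
    (t := φ ⁻¹' Iic s) (measurableSet_Iic.preimage φ.measurable) hK.measure_lt_top.ne
  have h2 : K \ φ ⁻¹' Iic s = K ∩ φ ⁻¹' Ioi s := by
    ext; simp
  rw [h2] at this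
  linarith

theorem measureReal_inter_preimage_Ioc [IsFiniteMeasureOnCompacts μ] {K : Set Y}
    (hK : IsCompact K) (φ : Y →L[ℝ] ℝ) {s t : ℝ} (hst : s ≤ t) :
    μ.real (K ∩ φ ⁻¹' Ioc s t) = μ.real (K ∩ φ ⁻¹' Iic t) - μ.real (K ∩ φ ⁻¹' Iic s) := by
  have := measureReal_inter_add_sdiff (μ := μ) (s := K ∩ φ ⁻¹' Iic t)
    (t := φ ⁻¹' Iic s) (measurableSet_Iic.preimage φ.measurable)
    ((measure_mono inter_subset_left).trans_lt hK.measure_lt_top).ne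
  have h1 : K ∩ φ ⁻¹' Iic t ∩ φ ⁻¹' Iic s = K ∩ φ ⁻¹' Iic s := by
    ext; simp; intros; linarith
  have h2 : (K ∩ φ ⁻¹' Iic t) \ φ ⁻¹' Iic s = K ∩ φ ⁻¹' Ioc s t := by
    ext; simp; tauto
  rw [h1, h2] at this
  linarith

variable [μ.IsAddHaarMeasure]

theorem subset_of_marginal_eq {K L : Set Y} (hK : Convex ℝ K) (hKi : (interior K).Nonempty)
    (hL : IsClosed L) (hLc : Convex ℝ L) (hLn : L.Nonempty)
    (h : ∀ φ : Y →L[ℝ] ℝ, φ ≠ 0 → (μ.restrict K).map φ = (μ.restrict L).map φ) : K ⊆ L := by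
  intro x hx
  by_contra hxL
  obtain ⟨φ, s, hLs, hxs⟩ := geometric_hahn_banach_closed_point hLc hL hxL
  have hφ : φ ≠ 0 := by
    rintro rfl
    obtain ⟨y, hy⟩ := hLn
    have := hLs y hy
    simp only [zero_apply] at this hxs
    linarith
  have hm := congrArg (fun ν : Measure ℝ => ν (Ioi s)) (h φ hφ)
  simp only [Measure.map_apply φ.measurable measurableSet_Ioi,
    Measure.restrict_apply (measurableSet_Ioi.preimage φ.measurable)] at hm
  have hempty : φ ⁻¹' Ioi s ∩ L = ∅ := by
    ext y
    simp only [mem_inter_iff, mem_preimage, mem_Ioi, mem_empty_iff_false, iff_false, not_and]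
    exact fun h1 h2 => absurd (hLs y h2) (by linarith)
  have hopen : IsOpen (φ ⁻¹' Ioi s) := isOpen_Ioi.preimage φ.continuous
  have hcl : x ∈ closure (interior K) := by
    rw [hK.closure_interior_eq_closure_of_nonempty_interior hKi]
    exact subset_closure hx
  have hne : (φ ⁻¹' Ioi s ∩ interior K).Nonempty := mem_closure_iff.1 hcl _ hopen hxs
  have hpos := (hopen.inter isOpen_interior).measure_pos μ hne
  rw [hempty, measure_empty] at hm
  exact hpos.ne' (measure_mono_null (inter_subset_inter_right _ interior_subset) hm)

variable [FiniteDimensional ℝ Y]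

theorem measure_preimage_singleton_eq_zero {φ : Y →L[ℝ] ℝ} (hφ : φ ≠ 0) (s : ℝ) :
    μ (φ ⁻¹' {s}) = 0 := by
  have hφ' : LinearMap.ker φ.toLinearMap ≠ ⊤ := fun h =>
    hφ (ContinuousLinearMap.coe_injective (LinearMap.ker_eq_top.1 h))
  rcases (φ ⁻¹' {s}).eq_empty_or_nonempty with h | ⟨x, hx⟩
  · simp [h]
  · have : φ ⁻¹' {s} = (fun y => -x + y) ⁻¹' (LinearMap.ker φ.toLinearMap : Set Y) := by
      ext y
      have hx' : φ x = s := hx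
      simp only [mem_preimage, mem_singleton_iff, ← hx', SetLike.mem_coe, LinearMap.mem_ker,
        ContinuousLinearMap.coe_coe, map_add, map_neg]
      constructor <;> intro h <;> linarith
    rw [this, measure_preimage_add]
    exact Measure.addHaar_submodule μ _ hφ'

theorem PrekopaLeindler.isLogConcaveCDF (hμ : PrekopaLeindler μ) {K : Set Y} (hK : IsCompact K)
    (hKc : Convex ℝ K) {φ : Y →L[ℝ] ℝ} (hφ : φ ≠ 0) :
    IsLogConcaveCDF (fun s => μ.real (K ∩ φ ⁻¹' Iic s)) (μ.real K) := by
  have fin : ∀ T : Set ℝ, μ (K ∩ φ ⁻¹' T) ≠ ⊤ := fun T =>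
    ((measure_mono inter_subset_left).trans_lt hK.measure_lt_top).ne
  have hbdd := (hK.image φ.continuous).isBounded
  have hmono : Monotone fun s => μ.real (K ∩ φ ⁻¹' Iic s) := fun s t hst =>
    measureReal_mono (by gcongr) (fin _)
  have hkey : ∀ {I : Set ℝ} (_ : MeasurableSet I) {J : Set ℝ} (_ : MeasurableSet J) {T : Set ℝ}
      (_ : MeasurableSet T) {a b : ℝ} (_ : 0 < a) (_ : 0 < b) (_ : a + b = 1)
      (_ : ∀ s ∈ I, ∀ t ∈ J, a * s + b * t ∈ T), 0 < μ.real (K ∩ φ ⁻¹' I) →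
      0 < μ.real (K ∩ φ ⁻¹' J) → 0 < μ.real (K ∩ φ ⁻¹' T) ∧
      a • Real.log (μ.real (K ∩ φ ⁻¹' I)) + b • Real.log (μ.real (K ∩ φ ⁻¹' J)) ≤
        Real.log (μ.real (K ∩ φ ⁻¹' T)) := by
    intro I hI J hJ T hT a b ha hb hab h hIpos hJpos
    have := hμ.measureReal_rpow_mul_le ha hb hab
      (hK.measurableSet.inter (hI.preimage φ.measurable))
      (hK.measurableSet.inter (hJ.preimage φ.measurable))
      (hK.measurableSet.inter (hT.preimage φ.measurable)) (fin _)
      ((smul_inter_preimage_add_subset φ h).trans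
        (inter_subset_inter_left _ (hKc.set_combo_subset ha.le hb.le hab)))
    have hpos : 0 < μ.real (K ∩ φ ⁻¹' I) ^ a * μ.real (K ∩ φ ⁻¹' J) ^ b := by positivity
    refine ⟨hpos.trans_le this, ?_⟩
    rw [smul_eq_mul, smul_eq_mul, ← Real.log_rpow hIpos, ← Real.log_rpow hJpos,
      ← Real.log_mul (by positivity) (by positivity)]
    exact Real.log_le_log hpos this
  refine ⟨hmono, ?_, ?_, ?_, ?_, ?_⟩
  · set ν := (μ.restrict K).map φ with hν
    have : IsFiniteMeasure (μ.restrict K) := ⟨by simpa using hK.measure_lt_top⟩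
    have hνI : ∀ T, MeasurableSet T → ν T = μ (K ∩ φ ⁻¹' T) := fun T hT => by
      rw [hν, Measure.map_apply φ.measurable hT,
        Measure.restrict_apply (hT.preimage φ.measurable), inter_comm]
    have : NullSingletonClass ν := ⟨fun s => by
      rw [hνI _ (measurableSet_singleton s)]
      exact measure_mono_null inter_subset_right (measure_preimage_singleton_eq_zero hφ s)⟩
    have hcont := (intervalIntegral.continuous_primitive (μ := ν) (f := fun _ => (1 : ℝ))
      (fun a b => intervalIntegrable_const) 0).add_const (ν.real (Iic 0))
    convert hcont using 2 with s
    rw [← intervalIntegral.integral_Iic_sub_Iic (by simp) (by simp)]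
    simp [measureReal_def, hνI]
  · obtain ⟨m, hm⟩ := hbdd.bddBelow
    refine tendsto_const_nhds.congr' ?_
    filter_upwards [eventually_lt_atBot m] with s hs
    have : K ∩ φ ⁻¹' Iic s = ∅ := by
      ext x
      simp only [mem_inter_iff, mem_preimage, mem_Iic, mem_empty_iff_false, iff_false, not_and]
      exact fun hx h => absurd (hm (mem_image_of_mem φ hx)) (by linarith)
    simp [this]
  · obtain ⟨m, hm⟩ := hbdd.bddAbove
    refine tendsto_const_nhds.congr' ?_
    filter_upwards [eventually_ge_atTop m] with s hs
    have : K ∩ φ ⁻¹' Iic s = K :=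
      inter_eq_left.2 fun x hx => (hm (mem_image_of_mem φ hx)).trans hs
    simp [this]
  · have main : ∀ ⦃x : ℝ⦄, x ∈ {s | 0 < μ.real (K ∩ φ ⁻¹' Iic s)} → ∀ ⦃y : ℝ⦄,
        y ∈ {s | 0 < μ.real (K ∩ φ ⁻¹' Iic s)} → ∀ ⦃a b : ℝ⦄, 0 < a → 0 < b → a + b = 1 → _ :=
      fun x hx y hy a b ha hb hab => hkey measurableSet_Iic measurableSet_Iic measurableSet_Iic
        (T := Iic (a • x + b • y)) ha hb hab (fun s hs t ht => by
          simp only [mem_Iic, smul_eq_mul] at *; gcongr) hx hy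
    exact concaveOn_iff_forall_pos.2 ⟨convex_iff_forall_pos.2 fun x hx y hy a b ha hb hab =>
      (main hx hy ha hb hab).1, fun x hx y hy a b ha hb hab => (main hx hy ha hb hab).2⟩
  · simp only [← measureReal_inter_preimage_Ioi hK, ← sub_pos (b := μ.real (K ∩ _))]
    have main : ∀ ⦃x : ℝ⦄, x ∈ {s | 0 < μ.real (K ∩ φ ⁻¹' Ioi s)} → ∀ ⦃y : ℝ⦄,
        y ∈ {s | 0 < μ.real (K ∩ φ ⁻¹' Ioi s)} → ∀ ⦃a b : ℝ⦄, 0 < a → 0 < b → a + b = 1 → _ :=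
      fun x hx y hy a b ha hb hab => hkey measurableSet_Ioi measurableSet_Ioi measurableSet_Ioi
        (T := Ioi (a • x + b • y)) ha hb hab (fun s hs t ht => by
          simp only [mem_Ioi, smul_eq_mul] at *; gcongr) hx hy
    exact concaveOn_iff_forall_pos.2 ⟨convex_iff_forall_pos.2 fun x hx y hy a b ha hb hab =>
      (main hx hy ha hb hab).1, fun x hx y hy a b ha hb hab => (main hx hy ha hb hab).2⟩

/-- Equality in the Brunn–Minkowski inequality for two bodies of the same volume forces all
one-dimensional marginals to agree up to translation. -/
theorem PrekopaLeindler.exists_marginal_eq (hμ : PrekopaLeindler μ) {K L : Set Y}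
    (hK : IsCompact K) (hKc : Convex ℝ K) (hL : IsCompact L) (hLc : Convex ℝ L)
    (hKL : μ K = μ L) {α β : ℝ} (hα : 0 < α) (hβ : 0 < β)
    (hαβ : α + β = 1) (hle : μ (α • K + β • L) ≤ μ K) {φ : Y →L[ℝ] ℝ} (hφ : φ ≠ 0) :
    ∃ c : ℝ, (μ.restrict K).map φ = ((μ.restrict L).map φ).map (· + c) := by
  have hP : IsCompact (α • K + β • L) := (hK.smul α).add (hL.smul β)
  have hPc : Convex ℝ (α • K + β • L) := (hKc.smul α).add (hLc.smul β)
  have hPK : μ (α • K + β • L) = μ K := by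
    refine le_antisymm hle ?_
    have := hμ.measure_rpow_mul_le hα hβ hαβ hK.measurableSet hL.measurableSet hP.measurableSet
      subset_rfl
    rwa [← hKL, ← ENNReal.rpow_add_of_nonneg _ _ hα.le hβ.le, hαβ, ENNReal.rpow_one] at this
  have rK : μ.real L = μ.real K := by simp [measureReal_def, hKL]
  have rP : μ.real (α • K + β • L) = μ.real K := by simp [measureReal_def, hPK]
  have fin : ∀ T : Set ℝ, μ ((α • K + β • L) ∩ φ ⁻¹' T) ≠ ⊤ := fun T =>
    ((measure_mono inter_subset_left).trans_lt hP.measure_lt_top).ne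
  have slab : ∀ {I J T : Set ℝ}, MeasurableSet I → MeasurableSet J → MeasurableSet T →
      (∀ s ∈ I, ∀ t ∈ J, α * s + β * t ∈ T) →
      μ.real (K ∩ φ ⁻¹' I) ^ α * μ.real (L ∩ φ ⁻¹' J) ^ β ≤
        μ.real ((α • K + β • L) ∩ φ ⁻¹' T) := fun hI hJ hT h =>
    hμ.measureReal_rpow_mul_le hα hβ hαβ (hK.measurableSet.inter (hI.preimage φ.measurable))
      (hL.measurableSet.inter (hJ.preimage φ.measurable))
      (hP.measurableSet.inter (hT.preimage φ.measurable)) (fin _)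
      (smul_inter_preimage_add_subset φ h)
  obtain ⟨c, hc⟩ := (hμ.isLogConcaveCDF hK hKc hφ).exists_eq_translate
    (rK ▸ hμ.isLogConcaveCDF hL hLc hφ) (rP ▸ hμ.isLogConcaveCDF hP hPc hφ) hα hβ hαβ
    (fun s t => slab measurableSet_Iic measurableSet_Iic measurableSet_Iic fun x hx y hy => by
      simp only [mem_Iic] at *; gcongr)
    (fun s t => by
      rw [← measureReal_inter_preimage_Ioi hK]
      nth_rewrite 1 [← rK]
      nth_rewrite 1 [← rP]
      rw [← measureReal_inter_preimage_Ioi hL, ← measureReal_inter_preimage_Ioi hP]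
      exact slab measurableSet_Ioi measurableSet_Ioi measurableSet_Ioi fun x hx y hy => by
        simp only [mem_Ioi] at *; gcongr)
    (fun s t δ hδ => by
      have hδ' : ∀ x : ℝ, x ≤ x + δ := fun x => by linarith
      rw [← measureReal_inter_preimage_Ioc hK φ (hδ' _),
        ← measureReal_inter_preimage_Ioc hL φ (hδ' _),
        ← measureReal_inter_preimage_Ioc hP φ (hδ' _)]
      refine slab measurableSet_Ioc measurableSet_Ioc measurableSet_Ioc fun x hx y hy => ?_
      simp only [mem_Ioc] at *
      constructor
      · have := mul_lt_mul_of_pos_left hx.1 hα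
        have := mul_lt_mul_of_pos_left hy.1 hβ
        linarith
      · have := mul_le_mul_of_nonneg_left hx.2 hα.le
        have := mul_le_mul_of_nonneg_left hy.2 hβ.le
        have : α * δ + β * δ = δ := by rw [← add_mul, hαβ, one_mul]
        linarith)
  have : IsFiniteMeasure (μ.restrict K) := ⟨by simpa using hK.measure_lt_top⟩
  have marg : ∀ {D : Set Y} (T : Set ℝ), MeasurableSet T →
      (μ.restrict D).map φ T = μ (D ∩ φ ⁻¹' T) := fun T hT => by
    rw [Measure.map_apply φ.measurable hT,
      Measure.restrict_apply (hT.preimage φ.measurable), inter_comm]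
  refine ⟨c, Measure.ext_of_Iic _ _ fun s => ?_⟩
  have hpre : (· + c) ⁻¹' Iic s = Iic (s - c) := by ext; simp [le_sub_iff_add_le]
  rw [Measure.map_apply (measurable_add_const c) measurableSet_Iic, hpre,
    marg _ measurableSet_Iic, marg _ measurableSet_Iic]
  refine (ENNReal.toReal_eq_toReal_iff' ?_ ?_).1 (hc s)
  · exact ((measure_mono inter_subset_left).trans_lt hK.measure_lt_top).ne
  · exact ((measure_mono inter_subset_left).trans_lt hL.measure_lt_top).ne

/-- Two bodies of the same volume and barycenter for which equality holds in the Brunn–Minkowski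
inequality are equal. -/
theorem PrekopaLeindler.eq_of_setIntegral_eq (hμ : PrekopaLeindler μ) {K L : Set Y}
    (hK : IsCompact K) (hKc : Convex ℝ K) (hKi : (interior K).Nonempty)
    (hL : IsCompact L) (hLc : Convex ℝ L) (hLi : (interior L).Nonempty)
    (hKL : μ K = μ L) {α β : ℝ} (hα : 0 < α) (hβ : 0 < β)
    (hαβ : α + β = 1) (hle : μ (α • K + β • L) ≤ μ K)
    (hbar : ∫ x in K, x ∂μ = ∫ x in L, x ∂μ) : K = L := by
  have : CompleteSpace Y := FiniteDimensional.complete ℝ Y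
  have hmarg : ∀ φ : Y →L[ℝ] ℝ, φ ≠ 0 → (μ.restrict K).map φ = (μ.restrict L).map φ := by
    intro φ hφ
    obtain ⟨c, hc⟩ := hμ.exists_marginal_eq hK hKc hL hLc hKL hα hβ hαβ hle hφ
    have h_int : ∀ {D : Set Y}, IsCompact D → ∫ t, t ∂((μ.restrict D).map φ) =
        φ (∫ x in D, x ∂μ) := fun {D} hD => by
      rw [integral_map φ.measurable.aemeasurable (by fun_prop),
        φ.integral_comp_comm (φ := fun x => x) (continuousOn_id.integrableOn_compact hD)]
    have hLfin : IsFiniteMeasure (μ.restrict L) := ⟨by simpa using hL.measure_lt_top⟩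
    have hi : Integrable (fun t : ℝ => t) ((μ.restrict L).map φ) := by
      rw [integrable_map_measure (by fun_prop) φ.measurable.aemeasurable]
      exact φ.continuous.continuousOn.integrableOn_compact hL
    have := h_int hK
    rw [hc, integral_map (by fun_prop) (by fun_prop), integral_add hi (integrable_const c),
      h_int hL, hbar] at this
    have hpos : 0 < μ.real L := by
      refine ENNReal.toReal_pos ?_ hL.measure_lt_top.ne
      exact (Measure.measure_pos_of_nonempty_interior μ hLi).ne'
    have hc0 : c = 0 := by
      have h2 : ∫ _, c ∂((μ.restrict L).map φ) = 0 := by linarith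
      rw [integral_const, measureReal_def, Measure.map_apply φ.measurable MeasurableSet.univ,
        preimage_univ, Measure.restrict_apply_univ] at h2
      rcases smul_eq_zero.1 h2 with h | h
      · exact absurd h hpos.ne'
      · exact h
    rw [hc, hc0]
    simp
  exact (subset_of_marginal_eq hKc hKi hL.isClosed hLc (hLi.mono interior_subset) hmarg).antisymm
    (subset_of_marginal_eq hLc hLi hK.isClosed hKc (hKi.mono interior_subset)
      fun φ hφ => (hmarg φ hφ).symm)

/-- The equality case of the Brunn–Minkowski inequality for convex bodies of the same volume. -/
theorem PrekopaLeindler.exists_eq_vadd (hμ : PrekopaLeindler μ) {K L : Set Y}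
    (hK : IsCompact K) (hKc : Convex ℝ K) (hKi : (interior K).Nonempty)
    (hL : IsCompact L) (hLc : Convex ℝ L) (hLi : (interior L).Nonempty)
    (hKL : μ K = μ L) {α β : ℝ} (hα : 0 < α) (hβ : 0 < β)
    (hαβ : α + β = 1) (hle : μ (α • K + β • L) ≤ μ K) : ∃ v : Y, K = v +ᵥ L := by
  have : CompleteSpace Y := FiniteDimensional.complete ℝ Y
  set v : Y := (μ.real L)⁻¹ • (∫ x in K, x ∂μ - ∫ x in L, x ∂μ) with hv
  have hpos : 0 < μ.real L := by
    refine ENNReal.toReal_pos ?_ hL.measure_lt_top.ne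
    exact (Measure.measure_pos_of_nonempty_interior μ hLi).ne'
  have hLfin : IsFiniteMeasure (μ.restrict L) := ⟨by simpa using hL.measure_lt_top⟩
  refine ⟨v, hμ.eq_of_setIntegral_eq hK hKc hKi (hL.vadd v) (hLc.vadd v) ?_ ?_ hα hβ hαβ ?_ ?_⟩
  · rw [interior_vadd]
    exact hLi.vadd_set
  · rw [measure_vadd, hKL]
  · have : α • K + β • (v +ᵥ L) = (β • v) +ᵥ (α • K + β • L) := by
      rw [← singleton_vadd, ← singleton_vadd, vadd_eq_add, vadd_eq_add, smul_add,
        smul_set_singleton, add_left_comm]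
    rwa [this, measure_vadd]
  · have himg : ∫ x in v +ᵥ L, x ∂μ = ∫ x in L, (v + x) ∂μ :=
      (measurePreserving_add_left μ v).setIntegral_image_emb (measurableEmbedding_addLeft v) _ L
    rw [himg, integral_add (g := fun x => x) (integrable_const v)
      (continuousOn_id.integrableOn_compact hL),
      integral_const, measureReal_restrict_apply_univ, hv, smul_inv_smul₀ hpos.ne']
    simp

end BrunnMinkowskiEquality

section Fibers

theorem preimage_prodMk_right_nonempty {X : Type*} {C : Set (ℝ × X)} {x : X} :
    ((fun r => (r, x)) ⁻¹' C).Nonempty ↔ x ∈ Prod.snd '' C := by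
  simp [Set.Nonempty]

theorem IsCompact.preimage_prodMk_right {X : Type*} [TopologicalSpace X] [T2Space X]
    {C : Set (ℝ × X)} (hC : IsCompact C) (x : X) : IsCompact ((fun r => (r, x)) ⁻¹' C) :=
  (hC.image continuous_fst).of_isClosed_subset (hC.isClosed.preimage (by fun_prop))
    fun r hr => ⟨(r, x), hr, rfl⟩

theorem exists_lt_measure_ofReal_lt {X : Type*} [MeasurableSpace X] (ν : Measure X)
    (f : X → ℝ≥0∞) {v : ℝ≥0∞} (hv : v < ν {x | 0 < f x}) :
    ∃ s : ℝ, 0 < s ∧ v < ν {x | ENNReal.ofReal s < f x} := by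
  have hU : {x | 0 < f x} = ⋃ n : ℕ, {x | ENNReal.ofReal (1 / ((n : ℝ) + 1)) < f x} := by
    ext x
    simp only [mem_ofPred_eq, mem_iUnion]
    refine ⟨fun h => ?_, fun ⟨n, hn⟩ => (zero_le).trans_lt hn⟩
    have hlim : Tendsto (fun n : ℕ => ENNReal.ofReal (1 / ((n : ℝ) + 1))) atTop (𝓝 0) := by
      simpa using ENNReal.tendsto_ofReal (tendsto_one_div_add_atTop_nhds_zero_nat (𝕜 := ℝ))
    exact (hlim.eventually_lt_const h).exists
  have hmono : Monotone fun n : ℕ => {x | ENNReal.ofReal (1 / ((n : ℝ) + 1)) < f x} :=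
    fun m n hmn x hx => (ENNReal.ofReal_le_ofReal
      (one_div_le_one_div_of_le (by positivity) (by gcongr))).trans_lt hx
  rw [hU, hmono.measure_iUnion] at hv
  obtain ⟨n, hn⟩ := lt_iSup_iff.1 hv
  exact ⟨_, by positivity, hn⟩

theorem interior_smul_add_smul_nonempty {E : Type*} [AddCommGroup E] [Module ℝ E]
    [TopologicalSpace E] [IsTopologicalAddGroup E] [ContinuousSMul ℝ E] {A B : Set E} {α β : ℝ}
    (hα : α ≠ 0) (hA : (interior A).Nonempty) (hB : B.Nonempty) :
    (interior (α • A + β • B)).Nonempty := by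
  refine Nonempty.mono (subset_interior_add_left) (Nonempty.add ?_ hB.smul_set)
  rw [interior_smul₀ hα]
  exact hA.smul_set

variable {X : Type*} [NormedAddCommGroup X] [NormedSpace ℝ X]

theorem Convex.preimage_prodMk_right {C : Set (ℝ × X)} (hC : Convex ℝ C) (x : X) :
    Convex ℝ ((fun r => (r, x)) ⁻¹' C) := by
  intro r hr s hs a b ha hb hab
  have := hC hr hs ha hb hab
  rwa [Prod.smul_mk, Prod.smul_mk, Prod.mk_add_mk, Convex.combo_self hab] at this

/-- Stretching a convex body along the first coordinate increases its volume by the amount of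
stretching times the measure of its projection. -/
theorem measure_prod_add_Icc [MeasurableSpace X] [BorelSpace X] [FiniteDimensional ℝ X]
    (ν : Measure X) [SFinite ν] {C : Set (ℝ × X)} (hC : IsCompact C) (hCc : Convex ℝ C)
    {l : ℝ} (hl : 0 ≤ l) :
    (volume : Measure ℝ).prod ν (C + Icc 0 l ×ˢ {0}) =
      (volume : Measure ℝ).prod ν C + ENNReal.ofReal l * ν (Prod.snd '' C) := by
  have hcomp : IsCompact (C + Icc 0 l ×ˢ {(0 : X)}) :=
    hC.add (isCompact_Icc.prod isCompact_singleton)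
  have hS : MeasurableSet (Prod.snd '' C) := (hC.image continuous_snd).measurableSet
  rw [Measure.prod_apply_symm hcomp.measurableSet, Measure.prod_apply_symm hC.measurableSet,
    ← lintegral_indicator_const hS, ← lintegral_add_right _ (measurable_const.indicator hS)]
  congr 1 with x
  have hfib : (fun r => (r, x)) ⁻¹' (C + Icc 0 l ×ˢ {(0 : X)}) =
      (fun r => (r, x)) ⁻¹' C + Icc 0 l := by
    ext r
    simp only [mem_preimage, Set.mem_add, Prod.exists, mem_prod, mem_singleton_iff, Prod.mk_add_mk,
      Prod.mk.injEq]
    constructor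
    · rintro ⟨a, y, hay, b, z, ⟨hb, rfl⟩, rfl, rfl⟩
      exact ⟨a, by simpa using hay, b, hb, rfl⟩
    · rintro ⟨a, ha, b, hb, rfl⟩
      exact ⟨a, x, ha, b, 0, ⟨hb, rfl⟩, rfl, add_zero x⟩
  rw [hfib]
  by_cases hx : x ∈ Prod.snd '' C
  · have hne := preimage_prodMk_right_nonempty.2 hx
    have hI := eq_Icc_of_connected_compact ⟨hne, (hCc.preimage_prodMk_right x).isPreconnected⟩
      (hC.preimage_prodMk_right x)
    have hle := nonempty_Icc.1 (hI ▸ hne)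
    rw [hI, Icc_add_Icc hle hl, indicator_of_mem hx, Real.volume_Icc, Real.volume_Icc,
      ← ENNReal.ofReal_add (by linarith) hl]
    congr 1
    ring
  · have : (fun r => (r, x)) ⁻¹' C = ∅ :=
      not_nonempty_iff_eq_empty.1 (mt preimage_prodMk_right_nonempty.1 hx)
    simp [this, hx]

variable [MeasurableSpace X] [BorelSpace X] [FiniteDimensional ℝ X] {ν : Measure X}

theorem measure_image_snd_le [ν.IsAddHaarMeasure] {A : Set (ℝ × X)} (hAc : Convex ℝ A)
    (hAi : (interior A).Nonempty) :
    ν (Prod.snd '' A) ≤ ν {x | 0 < volume ((fun r => (r, x)) ⁻¹' A)} := by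
  have hcl : Prod.snd '' A ⊆ closure (Prod.snd '' interior A) :=
    (image_mono (by
      rw [hAc.closure_interior_eq_closure_of_nonempty_interior hAi]; exact subset_closure)).trans
      (image_closure_subset_closure_image continuous_snd)
  have hconv : Convex ℝ (Prod.snd '' interior A) :=
    hAc.interior.linear_image (LinearMap.snd ℝ ℝ X)
  refine (measure_mono (hcl.trans (closure_eq_self_union_frontier _).subset)).trans
    ((measure_union_le _ _).trans ?_)
  rw [hconv.addHaar_frontier ν, add_zero]
  refine measure_mono fun x hx => ?_
  have hopen : IsOpen ((fun r => (r, x)) ⁻¹' interior A) := isOpen_interior.preimage (by fun_prop)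
  exact (hopen.measure_pos volume (preimage_prodMk_right_nonempty.2 hx)).trans_le
    (measure_mono (preimage_mono interior_subset))

/-- If the Bonnesen inequality holds with equality for two bodies with projections of the same
measure, then the projection of their combination has at most that measure. -/
theorem PrekopaLeindler.measure_image_snd_smul_add_smul_le [ν.IsAddHaarMeasure]
    (hν : PrekopaLeindler ν) {α β : ℝ}
    (hα : 0 < α) (hβ : 0 < β) (hαβ : α + β = 1) {A B : Set (ℝ × X)}
    (hA : IsCompact A) (hAc : Convex ℝ A) (hAi : (interior A).Nonempty)
    (hB : IsCompact B) (hBc : Convex ℝ B) (hBi : (interior B).Nonempty)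
    (hAB : ν (Prod.snd '' B) = ν (Prod.snd '' A))
    (hle : (volume : Measure ℝ).prod ν (α • A + β • B) ≤
      ENNReal.ofReal α * (volume : Measure ℝ).prod ν A +
        ENNReal.ofReal β * (volume : Measure ℝ).prod ν B) :
    ν (Prod.snd '' (α • A + β • B)) ≤ ν (Prod.snd '' A) := by
  set P := α • A + β • B with hP_def
  set M := ν (Prod.snd '' A) with hM
  have hP : IsCompact P := (hA.smul α).add (hB.smul β)
  have hPc : Convex ℝ P := (hAc.smul α).add (hBc.smul β)
  have hPi : (interior P).Nonempty :=
    interior_smul_add_smul_nonempty hα.ne' hAi (hBi.mono interior_subset)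
  let f : Set (ℝ × X) → X → ℝ≥0∞ := fun U x => volume ((fun r => (r, x)) ⁻¹' U)
  let a : Set (ℝ × X) → ℝ → ℝ≥0∞ := fun U =>
    (Ioi 0).indicator fun s => ν {x | ENNReal.ofReal s < f U x}
  have hf : ∀ {U}, IsCompact U → Measurable (f U) := fun hU =>
    measurable_measure_prodMk_right hU.measurableSet
  have hSmeas : ∀ {U}, IsCompact U → ∀ s : ℝ, MeasurableSet {x | ENNReal.ofReal s < f U x} :=
    fun hU s => measurableSet_lt measurable_const (hf hU)
  have ha : ∀ {U}, IsCompact U → Measurable (a U) := fun {U} hU => by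
    refine Measurable.indicator ?_ measurableSet_Ioi
    refine measurable_measure_prodMk_left (ν := ν) (s := {p : ℝ × X | ENNReal.ofReal p.1 < f U p.2})
      (measurableSet_lt (by fun_prop) ((hf hU).comp measurable_snd))
  have h_int : ∀ {U}, IsCompact U → (volume : Measure ℝ).prod ν U = ∫⁻ s, a U s := fun {U} hU => by
    rw [Measure.prod_apply_symm hU.measurableSet,
      lintegral_eq_lintegral_measure_ofReal_lt ν (hf hU), lintegral_indicator measurableSet_Ioi]
  have hsub : ∀ {U : Set (ℝ × X)} (s : ℝ), a U s ≤ ν (Prod.snd '' U) := fun {U} s => by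
    refine (indicator_le_self _ _ _).trans (measure_mono fun x hx => ?_)
    refine preimage_prodMk_right_nonempty.1 (nonempty_of_measure_ne_zero (μ := volume) ?_)
    exact (zero_le.trans_lt hx).ne'
  have hsup : ∀ {U : Set (ℝ × X)}, Convex ℝ U → (interior U).Nonempty →
      ∀ v < ν (Prod.snd '' U), ∃ s, 0 < s ∧ v < a U s := fun hUc hUi v hv => by
    obtain ⟨s, hs, h⟩ := exists_lt_measure_ofReal_lt ν _
      (hv.trans_le (measure_image_snd_le hUc hUi))
    exact ⟨s, hs, by simpa only [a, indicator_of_mem (mem_Ioi.2 hs)] using h⟩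
  have hcombo : ∀ {s t : ℝ}, 0 < s → 0 < t →
      α • {x | ENNReal.ofReal s < f A x} + β • {x | ENNReal.ofReal t < f B x} ⊆
        {x | ENNReal.ofReal (α * s + β * t) < f P x} := by
    rintro s t hs ht _ ⟨_, ⟨x, hx, rfl⟩, _, ⟨y, hy, rfl⟩, rfl⟩
    have hne : ∀ {U : Set (ℝ × X)} {s : ℝ} {x}, ENNReal.ofReal s < f U x →
        ((fun r => (r, x)) ⁻¹' U).Nonempty := fun h =>
      nonempty_of_measure_ne_zero (μ := volume) (zero_le.trans_lt h).ne'
    have hadd := Real.volume_smul_add_smul_le hα hβ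
      (hA.preimage_prodMk_right x).measurableSet (hB.preimage_prodMk_right y).measurableSet
      (hne hx) (hne hy) (C := (fun r => (r, α • x + β • y)) ⁻¹' P) (by
        rintro _ ⟨_, ⟨r, hr, rfl⟩, _, ⟨q, hq, rfl⟩, rfl⟩
        exact Set.add_mem_add (smul_mem_smul_set (mem_preimage.1 hr))
          (smul_mem_smul_set (mem_preimage.1 hq)))
    refine lt_of_lt_of_le ?_ hadd
    rw [ENNReal.ofReal_add (by positivity) (by positivity), ENNReal.ofReal_mul hα.le,
      ENNReal.ofReal_mul hβ.le]
    exact ENNReal.add_lt_add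
      ((ENNReal.mul_lt_mul_iff_right (by simpa using hα) ENNReal.ofReal_ne_top).2 hx)
      ((ENNReal.mul_lt_mul_iff_right (by simpa using hβ) ENNReal.ofReal_ne_top).2 hy)
  have hmin : ∀ s t, min (a A s) (a B t) ≤ min (a P (α * s + β * t)) M := by
    intro s t
    refine le_min ?_ ((min_le_left _ _).trans (hsub s))
    by_cases hs : 0 < s
    · by_cases ht : 0 < t
      · have hst : 0 < α * s + β * t := by positivity
        simp only [a, indicator_of_mem (mem_Ioi.2 hs), indicator_of_mem (mem_Ioi.2 ht),
          indicator_of_mem (mem_Ioi.2 hst)]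
        refine le_trans ?_ (hν.measure_rpow_mul_le hα hβ hαβ (hSmeas hA s) (hSmeas hB t)
          (hSmeas hP _) (hcombo hs ht))
        calc _ = min _ _ ^ α * min _ _ ^ β := by
              rw [← ENNReal.rpow_add_of_nonneg _ _ hα.le hβ.le, hαβ, ENNReal.rpow_one]
          _ ≤ _ := by
              gcongr
              · exact min_le_left _ _
              · exact min_le_right _ _
      · simp [a, ht]
    · simp [a, hs]
  have hPT : ∫⁻ s, a P s ≠ ⊤ := h_int hP ▸ hP.measure_lt_top.ne
  have hM' := Real.lintegral_add_le_of_min_le hα hβ (ha hA) (ha hB)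
    ((ha hP).min measurable_const) hsub (fun s => (hsub s).trans hAB.le)
    (fun v hv => (hsup hAc hAi v hv).imp fun _ h => h.2)
    (fun v hv => (hsup hBc hBi v (hv.trans_le hAB.ge)).imp fun _ h => h.2) hmin
  rw [h_int hA, h_int hB, h_int hP] at hle
  have hae := ae_eq_of_ae_le_of_lintegral_le (ae_of_all volume fun s => min_le_left (a P s) M)
    (ne_top_of_le_ne_top hPT (lintegral_mono fun s => min_le_left _ _)) (ha hP).aemeasurable
    (hle.trans hM')
  by_contra! hlt
  obtain ⟨s, hs, hMs⟩ := hsup hPc hPi M hlt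
  have hnull : volume (Ioo 0 s) = 0 := by
    refine measure_mono_null (fun t ht => ?_) (ae_iff.1 hae)
    have : a P s ≤ a P t := by
      simp only [a, indicator_of_mem (mem_Ioi.2 hs), indicator_of_mem (mem_Ioi.2 ht.1)]
      exact measure_mono fun x hx => (ENNReal.ofReal_le_ofReal ht.2.le).trans_lt hx
    simpa using hMs.trans_le this
  simp [hs.not_ge] at hnull

end Fibers

section Stretching

/-- The segment `[0, l • u]`, for `0 ≤ l`. -/
def segmentAlong {E : Type*} [AddCommGroup E] [Module ℝ E] (u : E) (l : ℝ) : Set E :=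
  LinearMap.toSpanSingleton ℝ E u '' Icc 0 l

section Algebra

variable {E : Type*} [AddCommGroup E] [Module ℝ E] {u : E}

theorem vadd_segmentAlong {l : ℝ} (hl : 0 ≤ l) (w : E) :
    w +ᵥ segmentAlong u l = segment ℝ w (w + l • u) := by
  have := image_segment ℝ (AffineMap.lineMap w (w + u) : ℝ →ᵃ[ℝ] E) 0 l
  rw [segment_eq_Icc hl] at this
  simp only [AffineMap.lineMap_apply, zero_smul, vsub_eq_sub, add_sub_cancel_left, vadd_eq_add,
    add_comm _ w, add_zero] at this
  rw [← this, segmentAlong, ← image_vadd, image_image]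
  refine image_congr fun t _ => ?_
  simp [AffineMap.lineMap_apply, add_comm]

theorem segmentAlong_zero : segmentAlong u 0 = 0 := by
  simp [segmentAlong, Set.singleton_zero]

theorem smul_segmentAlong {α : ℝ} (hα : 0 < α) (l : ℝ) :
    α • segmentAlong u l = segmentAlong u (α * l) := by
  have : Icc 0 (α * l) = α • Icc 0 l := by
    rw [LinearOrderedField.smul_Icc hα, mul_zero]
  rw [segmentAlong, segmentAlong, this, image_smul_set]

theorem segmentAlong_add {l l' : ℝ} (hl : 0 ≤ l) (hl' : 0 ≤ l') :
    segmentAlong u (l + l') = segmentAlong u l + segmentAlong u l' := by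
  rw [segmentAlong, segmentAlong, segmentAlong, ← image_add, Icc_add_Icc hl hl', add_zero]

theorem convex_segmentAlong (l : ℝ) : Convex ℝ (segmentAlong u l) :=
  (convex_Icc 0 l).linear_image _

theorem segmentAlong_nonempty {l : ℝ} (hl : 0 ≤ l) : (segmentAlong u l).Nonempty :=
  (nonempty_Icc.2 hl).image _

theorem smul_add_segmentAlong_add {α β : ℝ} (hα : 0 < α) (hβ : 0 < β) {A B : Set E} {l l' : ℝ}
    (hl : 0 ≤ l) (hl' : 0 ≤ l') :
    α • (A + segmentAlong u l) + β • (B + segmentAlong u l') =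
      (α • A + β • B) + segmentAlong u (α * l + β * l') := by
  rw [smul_add, smul_add, smul_segmentAlong hα, smul_segmentAlong hβ,
    segmentAlong_add (by positivity) (by positivity), add_add_add_comm]

theorem smul_vadd_add_smul_vadd (α β : ℝ) (v w : E) (A B : Set E) :
    α • (v +ᵥ A) + β • (w +ᵥ B) = (α • v + β • w) +ᵥ (α • A + β • B) := by
  simp only [← singleton_vadd, vadd_eq_add, smul_add, smul_set_singleton, ← singleton_add_singleton]
  rw [add_add_add_comm]

end Algebra

variable {X : Type*} [NormedAddCommGroup X] [NormedSpace ℝ X]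
  {E : Type*} [NormedAddCommGroup E] [NormedSpace ℝ E] {u : E}

theorem isCompact_segmentAlong (l : ℝ) : IsCompact (segmentAlong u l) :=
  isCompact_Icc.image (LinearMap.continuous_of_finiteDimensional _)

theorem image_segmentAlong {e : E ≃L[ℝ] ℝ × X} (heu : e u = (1, 0)) (l : ℝ) :
    e '' segmentAlong u l = Icc 0 l ×ˢ {0} := by
  rw [segmentAlong, image_image]
  ext ⟨a, x⟩
  simp [heu, eq_comm]

variable [MeasurableSpace X] [BorelSpace X] [FiniteDimensional ℝ X] {ν : Measure X}
  [MeasurableSpace E] [BorelSpace E] {μ : Measure E} {e : E ≃L[ℝ] ℝ × X}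

theorem measure_eq_measure_image (he : MeasurePreserving e μ ((volume : Measure ℝ).prod ν))
    (C : Set E) : μ C = (volume : Measure ℝ).prod ν (e '' C) := by
  have he' : MeasurePreserving e.toHomeomorph.toMeasurableEquiv μ ((volume : Measure ℝ).prod ν) :=
    he
  rw [← he'.measure_preimage_equiv]
  exact congrArg μ (preimage_image_eq C e.injective).symm

variable [ν.IsAddHaarMeasure]

/-- Stretching a convex body increases its volume by the amount of stretching times the measure
of its projection. -/
theorem measureReal_add_segmentAlong (he : MeasurePreserving e μ ((volume : Measure ℝ).prod ν))
    (heu : e u = (1, 0)) {C : Set E} (hC : IsCompact C) (hCc : Convex ℝ C) {l : ℝ} (hl : 0 ≤ l) :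
    μ.real (C + segmentAlong u l) = μ.real C + l * ν.real (Prod.snd '' (e '' C)) := by
  have hC' := hC.image e.continuous
  rw [measureReal_def, measureReal_def, measure_eq_measure_image he, image_add,
    image_segmentAlong heu,
    measure_prod_add_Icc ν hC' (hCc.linear_image e.toLinearMap) hl,
    ENNReal.toReal_add hC'.measure_lt_top.ne
      (ENNReal.mul_ne_top ENNReal.ofReal_ne_top (hC'.image continuous_snd).measure_lt_top.ne),
    ENNReal.toReal_mul, ENNReal.toReal_ofReal hl, ← measure_eq_measure_image he]
  rfl

/-- Equality holds in the Bonnesen inequality for two stretchings of the same convex body. -/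
theorem measureReal_smul_add_smul_of_eq_vadd
    (he : MeasurePreserving e μ ((volume : Measure ℝ).prod ν)) [μ.IsAddHaarMeasure]
    (heu : e u = (1, 0)) {α β : ℝ} (hα : 0 < α) (hβ : 0 < β) (hαβ : α + β = 1) {A B C : Set E}
    (hC : IsCompact C) (hCc : Convex ℝ C) {l l' : ℝ} (hl : 0 ≤ l) (hl' : 0 ≤ l') {v w : E}
    (hA : A = v +ᵥ (C + segmentAlong u l)) (hB : B = w +ᵥ (C + segmentAlong u l')) :
    μ.real (α • A + β • B) = α * μ.real A + β * μ.real B := by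
  rw [hA, hB, smul_vadd_add_smul_vadd, smul_add_segmentAlong_add hα hβ hl hl',
    ← hCc.add_smul hα.le hβ.le, hαβ, one_smul]
  simp only [measureReal_def, measure_vadd]
  simp only [← measureReal_def]
  rw [measureReal_add_segmentAlong he heu hC hCc (by positivity),
    measureReal_add_segmentAlong he heu hC hCc hl, measureReal_add_segmentAlong he heu hC hCc hl']
  linear_combination -(μ.real C) * hαβ

/-- If equality holds in the Bonnesen inequality, then the body of larger volume is a translate of
a stretching of the other. -/
theorem PrekopaLeindler.exists_eq_vadd_add_segmentAlong [FiniteDimensional ℝ E]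
    [μ.IsAddHaarMeasure] (hν : PrekopaLeindler ν)
    (he : MeasurePreserving e μ ((volume : Measure ℝ).prod ν)) (heu : e u = (1, 0))
    {α β : ℝ} (hα : 0 < α) (hβ : 0 < β) (hαβ : α + β = 1) {A B : Set E}
    (hA : IsCompact A) (hAc : Convex ℝ A) (hAi : (interior A).Nonempty)
    (hB : IsCompact B) (hBc : Convex ℝ B) (hBi : (interior B).Nonempty)
    (hAB : ν (Prod.snd '' (e '' B)) = ν (Prod.snd '' (e '' A)))
    (hA0 : ν (Prod.snd '' (e '' A)) ≠ 0) (hle : μ.real A ≤ μ.real B)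
    (heq : μ.real (α • A + β • B) = α * μ.real A + β * μ.real B) :
    ∃ l : ℝ, 0 ≤ l ∧ ∃ v : E, B = v +ᵥ (A + segmentAlong u l) := by
  have hμ : PrekopaLeindler μ :=
    (Real.prekopaLeindler_volume.prod hν).of_measurePreserving e.symm.toLinearMap
      (MeasurePreserving.symm e.toHomeomorph.toMeasurableEquiv he)
  have hP : IsCompact (α • A + β • B) := (hA.smul α).add (hB.smul β)
  have hPc : Convex ℝ (α • A + β • B) := (hAc.smul α).add (hBc.smul β)
  have himage : e '' (α • A + β • B) = α • (e '' A) + β • (e '' B) := by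
    rw [image_add, image_smul_set, image_smul_set]
  have h_int : ∀ {D : Set E}, (interior D).Nonempty → (interior (e '' D)).Nonempty := fun h => by
    exact (e.toHomeomorph.image_interior _) ▸ h.image _
  have hAT : ν (Prod.snd '' (e '' A)) ≠ ⊤ :=
    ((hA.image e.continuous).image continuous_snd).measure_lt_top.ne
  have hproj : ν.real (Prod.snd '' (e '' (α • A + β • B))) ≤ ν.real (Prod.snd '' (e '' A)) := by
    refine ENNReal.toReal_mono hAT ?_
    rw [himage]
    refine hν.measure_image_snd_smul_add_smul_le hα hβ hαβ (hA.image e.continuous)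
      (hAc.linear_image e.toLinearMap) (h_int hAi) (hB.image e.continuous)
      (hBc.linear_image e.toLinearMap) (h_int hBi) hAB ?_
    rw [← himage, ← measure_eq_measure_image he, ← measure_eq_measure_image he,
      ← measure_eq_measure_image he, ← ofReal_measureReal hP.measure_lt_top.ne,
      ← ofReal_measureReal hA.measure_lt_top.ne, ← ofReal_measureReal hB.measure_lt_top.ne,
      ← ENNReal.ofReal_mul hα.le, ← ENNReal.ofReal_mul hβ.le,
      ← ENNReal.ofReal_add (by positivity) (by positivity), heq]
  have hpos : 0 < ν.real (Prod.snd '' (e '' A)) := ENNReal.toReal_pos hA0 hAT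
  set m := ν.real (Prod.snd '' (e '' A)) with hm
  set l := (μ.real B - μ.real A) / m with hl_def
  have hl : 0 ≤ l := div_nonneg (sub_nonneg.2 hle) hpos.le
  have hlm : l * m = μ.real B - μ.real A := div_mul_cancel₀ _ hpos.ne'
  have hA' : IsCompact (A + segmentAlong u l) := hA.add (isCompact_segmentAlong l)
  have hvol : μ.real (A + segmentAlong u l) = μ.real B := by
    rw [measureReal_add_segmentAlong he heu hA hAc hl, ← hm, hlm]
    ring
  obtain ⟨v, hv⟩ := hμ.exists_eq_vadd hA' (hAc.add (convex_segmentAlong l))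
    ((hAi.add (segmentAlong_nonempty hl)).mono subset_interior_add_left) hB hBc hBi
    ((ENNReal.toReal_eq_toReal_iff' hA'.measure_lt_top.ne hB.measure_lt_top.ne).1 hvol) hα hβ hαβ
    (by
      have := smul_add_segmentAlong_add (u := u) hα hβ (A := A) (B := B) hl le_rfl
      rw [segmentAlong_zero, add_zero, mul_zero, add_zero] at this
      rw [this]
      refine (ENNReal.toReal_le_toReal (hP.add (isCompact_segmentAlong _)).measure_lt_top.ne
        hA'.measure_lt_top.ne).1 ?_
      simp only [← measureReal_def]
      rw [measureReal_add_segmentAlong he heu hP hPc (by positivity), hvol, heq]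
      have h1 := mul_le_mul_of_nonneg_left hproj (mul_nonneg hα.le hl)
      rw [mul_assoc α l m, hlm] at h1
      linear_combination h1 + μ.real B * hαβ)
  exact ⟨l, hl, -v, by rw [hv, neg_vadd_vadd]⟩

end Stretching

section EuclideanCoordinates

theorem exists_hausdorffMeasure_toLp_image_eq (n : ℕ) : ∃ κ : ℝ≥0∞, κ ≠ 0 ∧ κ ≠ ⊤ ∧
    ∀ S : Set (Fin n → ℝ), μH[n] (WithLp.toLp 2 '' S : Set (EuclideanSpace ℝ (Fin n))) =
      κ * volume S := by
  set κ := (μH[n] : Measure (EuclideanSpace ℝ (Fin n))).addHaarScalarFactor volume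
  refine ⟨κ, ?_, ENNReal.coe_ne_top, fun S => ?_⟩
  · exact_mod_cast (Measure.addHaarScalarFactor_pos_of_isAddHaarMeasure _ _).ne'
  have he : MeasurePreserving (MeasurableEquiv.toLp 2 (Fin n → ℝ)) :=
    PiLp.volume_preserving_toLp (Fin n)
  rw [Measure.isAddLeftInvariant_eq_smul μH[n] volume, Measure.smul_apply,
    ENNReal.smul_def, smul_eq_mul, ← he.measure_preimage_equiv]
  exact congrArg (κ * volume ·) (preimage_image_eq S (WithLp.toLp_injective 2))

theorem OrthonormalBasis.exists_apply_zero_eq {n : ℕ} {u : EuclideanSpace ℝ (Fin (n + 1))}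
    (hu : ‖u‖ = 1) :
    ∃ b : OrthonormalBasis (Fin (n + 1)) ℝ (EuclideanSpace ℝ (Fin (n + 1))), b 0 = u := by
  have hv : Orthonormal ℝ (({0} : Set (Fin (n + 1))).domRestrict fun _ => u) := by
    refine ⟨fun _ => hu, fun i j hij => absurd (Subsingleton.elim i j) hij⟩
  obtain ⟨b, hb⟩ := hv.exists_orthonormalBasis_extension_of_card_eq (by simp)
  exact ⟨b, hb 0 rfl⟩

theorem exists_coordinates_hausdorffMeasure_eq {n : ℕ} {u : EuclideanSpace ℝ (Fin (n + 1))}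
    (hu : ‖u‖ = 1) : ∃ e : EuclideanSpace ℝ (Fin (n + 1)) ≃L[ℝ] ℝ × (Fin n → ℝ),
      MeasurePreserving e volume ((volume : Measure ℝ).prod volume) ∧ e u = (1, 0) ∧
      ∃ κ : ℝ≥0∞, κ ≠ 0 ∧ κ ≠ ⊤ ∧ ∀ A : Set (EuclideanSpace ℝ (Fin (n + 1))),
        μH[n] ((fun x => x - ⟪x, u⟫ • u) '' A) = κ * volume (Prod.snd '' (e '' A)) := by
  obtain ⟨b, rfl⟩ := OrthonormalBasis.exists_apply_zero_eq hu
  let e := b.repr.toContinuousLinearEquiv.trans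
    ((EuclideanSpace.equiv (Fin (n + 1)) ℝ).trans (Fin.consEquivL ℝ fun _ => ℝ).symm)
  have he : ∀ x, e x = (b.repr x 0, fun i => b.repr x i.succ) := fun x => rfl
  refine ⟨e, ?_, ?_, ?_⟩
  · exact ((volume_preserving_piFinSuccAbove (fun _ : Fin (n + 1) => ℝ) 0).comp
      (PiLp.volume_preserving_ofLp _)).comp b.measurePreserving_repr
  · rw [he]
    ext <;> simp
  · obtain ⟨κ, h0, hT, h⟩ := exists_hausdorffMeasure_toLp_image_eq n
    refine ⟨κ, h0, hT, fun A => ?_⟩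
    let ι : EuclideanSpace ℝ (Fin n) →ₗ[ℝ] EuclideanSpace ℝ (Fin (n + 1)) :=
      { toFun := fun y => b.repr.symm (WithLp.toLp 2 (Fin.cons 0 y.ofLp))
        map_add' := fun y z => by
          rw [← map_add, ← WithLp.toLp_add]
          congr 2
          ext i
          cases i using Fin.cases <;> simp
        map_smul' := fun c y => by
          rw [← map_smul, ← WithLp.toLp_smul]
          congr 2
          ext i
          cases i using Fin.cases <;> simp }
    have hι : Isometry ι := AddMonoidHomClass.isometry_of_norm _ fun y => by
      change ‖b.repr.symm _‖ = _
      rw [LinearIsometryEquiv.norm_map, EuclideanSpace.norm_eq, EuclideanSpace.norm_eq,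
        Fin.sum_univ_succ]
      simp
    rw [← h, ← hι.hausdorffMeasure_image (Or.inl n.cast_nonneg), image_image, image_image,
      image_image]
    congr 1
    refine image_congr fun x _ => b.repr.injective ?_
    change _ = b.repr (b.repr.symm _)
    rw [LinearIsometryEquiv.apply_symm_apply, he]
    ext i
    cases i using Fin.cases
    · simp [b.repr_apply_apply, real_inner_comm]
    · simp

end EuclideanCoordinates

end BonnesenProjections

theorem stretchOf_vadd_iff {d : ℕ} {K C : Set (EuclideanSpace ℝ (Fin d))}
    {u w : EuclideanSpace ℝ (Fin d)} :
    StretchOf K (w +ᵥ C) u ↔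
      ∃ l : ℝ, 0 ≤ l ∧ ∃ v : EuclideanSpace ℝ (Fin d), K = v +ᵥ (C + segmentAlong u l) := by
  refine exists_congr fun l => and_congr_right fun hl => ?_
  have key : ∀ v : EuclideanSpace ℝ (Fin d),
      (w +ᵥ C) + segment ℝ v (v + l • u) = (w + v) +ᵥ (C + segmentAlong u l) := fun v => by
    rw [← vadd_segmentAlong hl]
    simp only [← Set.singleton_vadd, vadd_eq_add, ← Set.singleton_add_singleton]
    rw [add_add_add_comm]
  simp only [key]
  exact ⟨fun ⟨v, hv⟩ => ⟨w + v, hv⟩, fun ⟨v, hv⟩ => ⟨v - w, by rwa [add_sub_cancel]⟩⟩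

/-- Equality case of the Bonnesen inequality for projections (with the
projection volumes normalized to `1` and `α + β = 1`): equality holds iff
`A` and `B` are obtained by stretching along `u` from translates of a common
convex body. -/
theorem bonnesen_projections_equality (d : ℕ) (hd : 2 ≤ d)
    (u : EuclideanSpace ℝ (Fin d)) (hu : ‖u‖ = 1)
    (A B : Set (EuclideanSpace ℝ (Fin d)))
    (hAc : IsCompact A) (hAcv : Convex ℝ A) (hAi : (interior A).Nonempty)
    (hBc : IsCompact B) (hBcv : Convex ℝ B) (hBi : (interior B).Nonempty)
    (hMA : (μH[(d : ℝ) - 1] ((fun x => x - ⟪x, u⟫ • u) '' A)).toReal = 1)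
    (hMB : (μH[(d : ℝ) - 1] ((fun x => x - ⟪x, u⟫ • u) '' B)).toReal = 1)
    (α β : ℝ) (hα : 0 < α) (hβ : 0 < β) (hαβ : α + β = 1) :
    (volume (α • A + β • B)).toReal =
        α * (volume A).toReal + β * (volume B).toReal ↔
      ∃ (C : Set (EuclideanSpace ℝ (Fin d))) (w₁ w₂ : EuclideanSpace ℝ (Fin d)),
        IsCompact C ∧ Convex ℝ C ∧ (interior C).Nonempty ∧
        StretchOf A (w₁ +ᵥ C) u ∧ StretchOf B (w₂ +ᵥ C) u := by
  obtain ⟨n, rfl⟩ : ∃ n, d = n + 1 := ⟨d - 1, by lia⟩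
  obtain ⟨e, he, heu, κ, hκ0, hκT, hκ⟩ := exists_coordinates_hausdorffMeasure_eq hu
  rw [show ((n + 1 : ℕ) : ℝ) - 1 = n by simp, hκ] at hMA hMB
  simp only [stretchOf_vadd_iff]
  have hm : volume (Prod.snd '' (e '' B)) = volume (Prod.snd '' (e '' A)) := by
    have hinj := hMB.trans hMA.symm
    rw [ENNReal.toReal_mul, ENNReal.toReal_mul,
      mul_right_inj' (ENNReal.toReal_ne_zero.2 ⟨hκ0, hκT⟩)] at hinj
    exact (ENNReal.toReal_eq_toReal_iff'
      ((hBc.image e.continuous).image continuous_snd).measure_lt_top.ne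
      ((hAc.image e.continuous).image continuous_snd).measure_lt_top.ne).1 hinj
  have hm0 : volume (Prod.snd '' (e '' A)) ≠ 0 := fun h => by simp [h] at hMA
  have hself : ∀ K : Set (EuclideanSpace ℝ (Fin (n + 1))),
      ∃ l : ℝ, 0 ≤ l ∧ ∃ v : EuclideanSpace ℝ (Fin (n + 1)), K = v +ᵥ (K + segmentAlong u l) :=
    fun K => ⟨0, le_rfl, 0, by rw [segmentAlong_zero, add_zero, zero_vadd]⟩
  have hPL := prekopaLeindler_volume_pi n
  constructor
  · intro heq
    rcases le_total (volume.real A) (volume.real B) with hle | hle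
    · exact ⟨A, 0, 0, hAc, hAcv, hAi, hself A, hPL.exists_eq_vadd_add_segmentAlong he heu hα hβ hαβ
        hAc hAcv hAi hBc hBcv hBi hm hm0 hle heq⟩
    · refine ⟨B, 0, 0, hBc, hBcv, hBi, hPL.exists_eq_vadd_add_segmentAlong he heu hβ hα
        (add_comm α β ▸ hαβ) hBc hBcv hBi hAc hAcv hAi hm.symm (hm ▸ hm0) hle ?_, hself B⟩
      rw [add_comm (β • B), add_comm (β * _)]
      exact heq
  · rintro ⟨C, -, -, hC, hCc, -, ⟨l, hl, v, hA⟩, l', hl', w, hB⟩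
    exact measureReal_smul_add_smul_of_eq_vadd he heu hα hβ hαβ hC hCc hl hl' hA hB
end

section
/- Let A, B be convex bodies in R^d with d ≥ 2, u a unit vector, L = u^⊥, with maximal section volumes M = N = 1 parallel to L. Let C = αA + βB for α, β > 0. With a_±, b_±, c_± denoting the section-height functions of A, B, C as in the definition of k_±, one has for all t ∈ (0, 1]: c_+((α+β)^{d-1} t) ≥ α a_+(t) + β b_+(t) and c_-((α+β)^{d-1} t) ≤ α a_-(t) + β b_-(t). -/
open MeasureTheory Pointwise
open scoped RealInnerProductSpace

/-- The `(d-1)`-volume of the section of `K` at height `p` in direction `u`. -/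
noncomputable def sectionVol (d : ℕ) (K : Set (EuclideanSpace ℝ (Fin d)))
    (u : EuclideanSpace ℝ (Fin d)) (p : ℝ) : ℝ :=
  (μH[(d : ℝ) - 1] (K ∩ {x | ⟪x, u⟫ = p})).toReal

open scoped ENNReal
open Set Filter Topology

theorem volume_add_volume_le_volume_add {K T : Set ℝ} (hK : IsCompact K) (hT : IsCompact T)
    (hK₀ : K.Nonempty) (hT₀ : T.Nonempty) :
    volume K + volume T ≤ volume (K + T) := by
  obtain ⟨m, hm⟩ := hK.exists_isGreatest hK₀
  obtain ⟨l, hl⟩ := hT.exists_isLeast hT₀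
  have hinter : volume ((l +ᵥ K) ∩ (m +ᵥ T)) = 0 := by
    refine measure_mono_null (t := {m + l}) ?_ (by simp)
    rintro _ ⟨⟨x, hx, rfl⟩, ⟨y, hy, hxy⟩⟩
    have h₁ := hm.2 hx
    have h₂ := hl.2 hy
    simp only [vadd_eq_add, mem_singleton_iff] at hxy ⊢
    linarith
  have hT' : MeasurableSet (m +ᵥ T) := (hT.vadd m).measurableSet
  calc volume K + volume T = volume (l +ᵥ K) + volume (m +ᵥ T) := by simp only [measure_vadd]
    _ = volume ((l +ᵥ K) ∪ (m +ᵥ T)) := by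
      rw [← measure_union_add_inter _ hT', hinter, add_zero]
    _ ≤ volume (K + T) := by
      refine measure_mono (union_subset ?_ ?_)
      · rintro _ ⟨x, hx, rfl⟩
        exact ⟨x, hx, l, hl.1, add_comm _ _⟩
      · rintro _ ⟨y, hy, rfl⟩
        exact ⟨m, hm.1, y, hy, rfl⟩

theorem ofReal_mul_volume_add_le {S T W : Set ℝ} (hS : MeasurableSet S) (hT : MeasurableSet T)
    (hS₀ : S.Nonempty) (hT₀ : T.Nonempty) {a b : ℝ} (ha : 0 < a) (hb : 0 < b)
    (hW : ∀ x ∈ S, ∀ y ∈ T, a * x + b * y ∈ W) :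
    ENNReal.ofReal a * volume S + ENNReal.ofReal b * volume T ≤ volume W := by
  have key : ∀ K ⊆ S, IsCompact K → ∀ R ⊆ T, IsCompact R →
      ENNReal.ofReal a * volume K + ENNReal.ofReal b * volume R ≤ volume W := by
    intro K hKS hK R hRT hR
    obtain ⟨x, hx⟩ := hS₀
    obtain ⟨y, hy⟩ := hT₀
    have h := volume_add_volume_le_volume_add ((hK.insert x).smul a) ((hR.insert y).smul b)
      ((insert_nonempty x K).smul_set) ((insert_nonempty y R).smul_set)
    simp only [Measure.addHaar_smul, Module.finrank_self, pow_one, abs_of_pos ha,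
      abs_of_pos hb] at h
    refine le_trans ?_ (h.trans (measure_mono ?_))
    · gcongr <;> exact subset_insert _ _
    · rintro _ ⟨_, ⟨p, hp, rfl⟩, _, ⟨q, hq, rfl⟩, rfl⟩
      exact hW p (insert_subset hx hKS hp) q (insert_subset hy hRT hq)
  rw [hS.measure_eq_iSup_isCompact, hT.measure_eq_iSup_isCompact]
  simp only [ENNReal.mul_iSup, iSup_and']
  exact ENNReal.biSup_add_biSup_le' ⟨∅, empty_subset _, isCompact_empty⟩
    ⟨∅, empty_subset _, isCompact_empty⟩ fun K hK R hR => key K hK.1 hK.2 R hR.1 hR.2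

theorem lintegral_eq_lintegral_Ioi_ofReal_lt {f : ℝ → ℝ≥0∞} (hf : Measurable f)
    (hf_top : ∀ x, f x ≠ ∞) :
    ∫⁻ x, f x = ∫⁻ t in Ioi (0 : ℝ), volume {x | ENNReal.ofReal t < f x} := by
  have h := lintegral_eq_lintegral_meas_lt volume (f := fun x => (f x).toReal)
    (Eventually.of_forall fun x => ENNReal.toReal_nonneg) hf.ennreal_toReal.aemeasurable
  simp only [ENNReal.ofReal_toReal (hf_top _)] at h
  rw [h]
  refine setLIntegral_congr_fun measurableSet_Ioi fun t ht => ?_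
  simp only [ENNReal.ofReal_lt_iff_lt_toReal (le_of_lt ht) (hf_top _)]

theorem ENNReal.geom_mean_le_arith_mean2_weighted {a b : ℝ} (ha : 0 < a) (hb : 0 < b)
    (hab : a + b = 1) (x y : ℝ≥0∞) :
    x ^ a * y ^ b ≤ ENNReal.ofReal a * x + ENNReal.ofReal b * y := by
  by_cases hx : x = ∞
  · simp [hx, ENNReal.mul_top, ha]
  by_cases hy : y = ∞
  · simp [hy, ENNReal.mul_top, hb]
  lift x to NNReal using hx
  lift y to NNReal using hy
  have h := NNReal.geom_mean_le_arith_mean2_weighted a.toNNReal b.toNNReal x y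
    (by rw [← Real.toNNReal_add ha.le hb.le, hab, Real.toNNReal_one])
  rw [Real.coe_toNNReal a ha.le, Real.coe_toNNReal b hb.le] at h
  rw [← ENNReal.coe_rpow_of_nonneg _ ha.le, ← ENNReal.coe_rpow_of_nonneg _ hb.le]
  rw [ENNReal.ofReal, ENNReal.ofReal]
  exact mod_cast h

theorem prekopa_leindler_real_of_iSup_eq_one {f g h : ℝ → ℝ≥0∞} (hf : Measurable f)
    (hg : Measurable g) (hh : Measurable h) (hf₁ : ⨆ x, f x = 1) (hg₁ : ⨆ x, g x = 1)
    {a b : ℝ} (ha : 0 < a) (hb : 0 < b) (hab : a + b = 1)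
    (H : ∀ x y, f x ^ a * g y ^ b ≤ h (a * x + b * y)) :
    (∫⁻ x, f x) ^ a * (∫⁻ x, g x) ^ b ≤ ∫⁻ x, h x := by
  have hf_le : ∀ x, f x ≤ 1 := fun x => hf₁ ▸ le_iSup f x
  have hg_le : ∀ x, g x ≤ 1 := fun x => hg₁ ▸ le_iSup g x
  refine (ENNReal.geom_mean_le_arith_mean2_weighted ha hb hab _ _).trans ?_
  refine le_trans ?_ (lintegral_mono fun x => min_le_left (h x) 1)
  rw [lintegral_eq_lintegral_Ioi_ofReal_lt hf fun x => ne_top_of_le_ne_top (by simp) (hf_le x),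
    lintegral_eq_lintegral_Ioi_ofReal_lt hg fun x => ne_top_of_le_ne_top (by simp) (hg_le x),
    lintegral_eq_lintegral_Ioi_ofReal_lt (hh.min measurable_const)
      fun x => ne_top_of_le_ne_top (by simp) (min_le_right _ 1),
    ← lintegral_const_mul' _ _ (by simp), ← lintegral_const_mul' _ _ (by simp)]
  refine (le_lintegral_add _ _).trans (lintegral_mono fun t => ?_)
  rcases lt_or_ge (ENNReal.ofReal t) 1 with ht | ht
  · have hS : {x | ENNReal.ofReal t < f x}.Nonempty :=
      nonempty_def.2 (lt_iSup_iff.1 (by rwa [hf₁]))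
    have hT : {x | ENNReal.ofReal t < g x}.Nonempty :=
      nonempty_def.2 (lt_iSup_iff.1 (by rwa [hg₁]))
    refine ofReal_mul_volume_add_le (measurableSet_lt measurable_const hf)
      (measurableSet_lt measurable_const hg) hS hT ha hb
      fun x hx y hy => lt_min (lt_of_lt_of_le ?_ (H x y)) ht
    calc ENNReal.ofReal t = ENNReal.ofReal t ^ a * ENNReal.ofReal t ^ b := by
          rw [← ENNReal.rpow_add_of_nonneg _ _ ha.le hb.le, hab, ENNReal.rpow_one]
      _ < f x ^ a * g y ^ b :=
          ENNReal.mul_lt_mul (ENNReal.rpow_lt_rpow hx ha) (ENNReal.rpow_lt_rpow hy hb)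
  · simp [not_lt_of_ge ((hf_le _).trans ht), not_lt_of_ge ((hg_le _).trans ht)]

theorem prekopa_leindler_real_of_iSup_ne_top {f g h : ℝ → ℝ≥0∞} (hf : Measurable f)
    (hg : Measurable g) (hh : Measurable h) (hf₁ : ⨆ x, f x ≠ ∞) (hg₁ : ⨆ x, g x ≠ ∞)
    {a b : ℝ} (ha : 0 < a) (hb : 0 < b) (hab : a + b = 1)
    (H : ∀ x y, f x ^ a * g y ^ b ≤ h (a * x + b * y)) :
    (∫⁻ x, f x) ^ a * (∫⁻ x, g x) ^ b ≤ ∫⁻ x, h x := by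
  set F := ⨆ x, f x with hF
  set G := ⨆ x, g x with hG
  rcases eq_or_ne F 0 with hF₀ | hF₀
  · simp [ENNReal.iSup_eq_zero.1 hF₀, ha]
  rcases eq_or_ne G 0 with hG₀ | hG₀
  · simp [ENNReal.iSup_eq_zero.1 hG₀, hb]
  have hFa₀ : F ^ a ≠ 0 := by simp [hF₀, hf₁]
  have hGb₀ : G ^ b ≠ 0 := by simp [hG₀, hg₁]
  have hFa : F ^ a ≠ ∞ := ENNReal.rpow_ne_top_of_nonneg ha.le hf₁
  have hGb : G ^ b ≠ ∞ := ENNReal.rpow_ne_top_of_nonneg hb.le hg₁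
  have h₁ := prekopa_leindler_real_of_iSup_eq_one (hf.const_mul F⁻¹) (hg.const_mul G⁻¹)
    (hh.const_mul ((F ^ a)⁻¹ * (G ^ b)⁻¹))
    (by rw [← ENNReal.mul_iSup, ← hF, ENNReal.inv_mul_cancel hF₀ hf₁])
    (by rw [← ENNReal.mul_iSup, ← hG, ENNReal.inv_mul_cancel hG₀ hg₁]) ha hb hab
    (fun x y => by
      rw [ENNReal.mul_rpow_of_nonneg _ _ ha.le, ENNReal.mul_rpow_of_nonneg _ _ hb.le,
        ENNReal.inv_rpow, ENNReal.inv_rpow, mul_mul_mul_comm]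
      gcongr
      exact H x y)
  rw [lintegral_const_mul _ hf, lintegral_const_mul _ hg, lintegral_const_mul _ hh,
    ENNReal.mul_rpow_of_nonneg _ _ ha.le, ENNReal.mul_rpow_of_nonneg _ _ hb.le,
    ENNReal.inv_rpow, ENNReal.inv_rpow, mul_mul_mul_comm] at h₁
  exact (ENNReal.mul_le_mul_iff_right (mul_ne_zero (by simpa using hFa) (by simpa using hGb))
    (ENNReal.mul_ne_top (by simpa using hFa₀) (by simpa using hGb₀))).1 h₁

/-- The Prékopa–Leindler inequality on the real line. -/
theorem prekopa_leindler_real {f g h : ℝ → ℝ≥0∞} (hf : Measurable f)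
    (hg : Measurable g) (hh : Measurable h)
    {a b : ℝ} (ha : 0 < a) (hb : 0 < b) (hab : a + b = 1)
    (H : ∀ x y, f x ^ a * g y ^ b ≤ h (a * x + b * y)) :
    (∫⁻ x, f x) ^ a * (∫⁻ x, g x) ^ b ≤ ∫⁻ x, h x := by
  have htrunc : ∀ {k : ℝ → ℝ≥0∞}, Measurable k →
      Tendsto (fun n : ℕ => ∫⁻ x, min (k x) n) atTop (𝓝 (∫⁻ x, k x)) := fun {k} hk =>
    lintegral_tendsto_of_tendsto_of_monotone
      (fun n => (hk.min measurable_const).aemeasurable)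
      (Eventually.of_forall fun x m n hmn => min_le_min_left _ (by exact_mod_cast hmn))
      (Eventually.of_forall fun x => by
        simpa using tendsto_const_nhds.min ENNReal.tendsto_nat_nhds_top)
  rcases eq_or_ne (∫⁻ x, f x) 0 with hf₀ | hf₀
  · simp [hf₀, ha]
  rcases eq_or_ne (∫⁻ x, g x) 0 with hg₀ | hg₀
  · simp [hg₀, hb]
  have hbdd : ∀ (k : ℝ → ℝ≥0∞) (n : ℕ), ⨆ x, min (k x) n ≠ ∞ := fun k n =>
    ne_top_of_le_ne_top (ENNReal.natCast_ne_top n) (iSup_le fun x => min_le_right _ _)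
  refine le_of_tendsto' (ENNReal.Tendsto.mul ((htrunc hf).ennrpow_const a) (Or.inl ?_)
    ((htrunc hg).ennrpow_const b) (Or.inl ?_)) fun n =>
    prekopa_leindler_real_of_iSup_ne_top (hf.min measurable_const) (hg.min measurable_const) hh
      (hbdd f n) (hbdd g n) ha hb hab fun x y => le_trans ?_ (H x y)
  · simp [hf₀, ha.not_gt]
  · simp [hg₀, hb.not_gt]
  · gcongr <;> exact min_le_left _ _

/-- The Prékopa–Leindler inequality. -/
theorem prekopa_leindler (n : ℕ) {f g h : (Fin n → ℝ) → ℝ≥0∞} (hf : Measurable f)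
    (hg : Measurable g) (hh : Measurable h)
    {a b : ℝ} (ha : 0 < a) (hb : 0 < b) (hab : a + b = 1)
    (H : ∀ x y, f x ^ a * g y ^ b ≤ h (a • x + b • y)) :
    (∫⁻ x, f x) ^ a * (∫⁻ x, g x) ^ b ≤ ∫⁻ x, h x := by
  induction n with
  | zero =>
    simp only [lintegral_unique, volume_pi, Measure.pi_univ, Finset.univ_eq_empty,
      Finset.prod_empty, mul_one]
    exact (H _ _).trans_eq (congrArg h (Subsingleton.elim _ _))
  | succ n ih =>
    have hcons : Measurable fun p : ℝ × (Fin n → ℝ) => (Fin.cons p.1 p.2 : Fin (n + 1) → ℝ) := by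
      simpa using! (MeasurableEquiv.piFinSuccAbove (fun _ : Fin (n + 1) => ℝ) 0).symm.measurable
    have fubini : ∀ {k : (Fin (n + 1) → ℝ) → ℝ≥0∞}, Measurable k →
        ∫⁻ x, k x = ∫⁻ s : ℝ, ∫⁻ v : Fin n → ℝ, k (Fin.cons s v) := fun {k} hk => by
      rw [← (volume_preserving_piFinSuccAbove
        (fun _ : Fin (n + 1) => ℝ) 0).symm.lintegral_comp hk,
        Measure.volume_eq_prod, lintegral_prod _ (by fun_prop)]
      simp [MeasurableEquiv.piFinSuccAbove_symm_apply, Fin.insertNthEquiv]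
    rw [fubini hf, fubini hg, fubini hh]
    refine prekopa_leindler_real (hf.comp hcons).lintegral_prod_right'
      (hg.comp hcons).lintegral_prod_right' (hh.comp hcons).lintegral_prod_right' ha hb hab
      fun s r => ?_
    refine ih (f := fun v => f (Fin.cons s v)) (g := fun v => g (Fin.cons r v))
      (h := fun v => h (Fin.cons (a * s + b * r) v)) (hf.comp (hcons.comp measurable_prodMk_left))
      (hg.comp (hcons.comp measurable_prodMk_left)) (hh.comp (hcons.comp measurable_prodMk_left))
      fun x y => (H _ _).trans_eq (congrArg h ?_)
    ext i
    refine Fin.cases ?_ (fun i => ?_) i <;> simp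

theorem volume_brunn_minkowski {n : ℕ} {X Y : Set (Fin n → ℝ)} (hX : IsCompact X)
    (hY : IsCompact Y) {a b : ℝ} (ha : 0 < a) (hb : 0 < b) (hab : a + b = 1) :
    volume X ^ a * volume Y ^ b ≤ volume (a • X + b • Y) := by
  have hZ := ((hX.smul a).add (hY.smul b)).measurableSet
  have h := prekopa_leindler n (measurable_one.indicator hX.measurableSet)
    (measurable_one.indicator hY.measurableSet) (measurable_one.indicator hZ) ha hb hab
    (fun x y => by
      by_cases hx : x ∈ X
      · by_cases hy : y ∈ Y
        · simp [hx, hy, indicator_of_mem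
            (add_mem_add (smul_mem_smul_set (a := a) hx) (smul_mem_smul_set (a := b) hy))]
        · simp [hy, hb]
      · simp [hx, ha])
  simpa only [lintegral_indicator_one, hX.measurableSet, hY.measurableSet, hZ] using h

/-- The multiplicative Brunn–Minkowski inequality for compact sets and an arbitrary additive Haar
measure on a Euclidean space. -/
theorem addHaar_brunn_minkowski {n : ℕ} (μ : Measure (EuclideanSpace ℝ (Fin n)))
    [μ.IsAddHaarMeasure] {X Y : Set (EuclideanSpace ℝ (Fin n))} (hX : IsCompact X)
    (hY : IsCompact Y) {a b : ℝ} (ha : 0 < a) (hb : 0 < b) (hab : a + b = 1) :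
    μ X ^ a * μ Y ^ b ≤ μ (a • X + b • Y) := by
  let e := EuclideanSpace.equiv (Fin n) ℝ
  have := e.isAddHaarMeasure_map μ
  obtain ⟨c, hμ⟩ : ∃ c : ℝ≥0∞, ∀ S, IsCompact S → μ S = c * volume (e '' S) := by
    refine ⟨Measure.addHaarScalarFactor (μ.map e) volume, fun S hS => ?_⟩
    have h := congrArg (fun ν : Measure (Fin n → ℝ) => ν (e '' S))
      (Measure.isAddLeftInvariant_eq_smul (μ.map e) volume)
    simp only [Measure.smul_apply] at h
    rw [Measure.map_apply e.continuous.measurable (hS.image e.continuous).measurableSet,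
      preimage_image_eq _ e.injective] at h
    exact h
  have himage : e '' (a • X + b • Y) = a • (e '' X) + b • (e '' Y) := by
    rw [image_add, image_smul_set, image_smul_set]
  rw [hμ X hX, hμ Y hY, hμ _ ((hX.smul a).add (hY.smul b)), himage,
    ENNReal.mul_rpow_of_nonneg _ _ ha.le, ENNReal.mul_rpow_of_nonneg _ _ hb.le,
    mul_mul_mul_comm, ← ENNReal.rpow_add_of_nonneg _ _ ha.le hb.le, hab, ENNReal.rpow_one]
  gcongr
  exact volume_brunn_minkowski (hX.image e.continuous) (hY.image e.continuous) ha hb hab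

theorem ofReal_add_pow_mul_le_addHaar {n : ℕ} (μ : Measure (EuclideanSpace ℝ (Fin n)))
    [μ.IsAddHaarMeasure] {X Y : Set (EuclideanSpace ℝ (Fin n))} (hX : IsCompact X)
    (hY : IsCompact Y) {a b : ℝ} (ha : 0 < a) (hb : 0 < b) {t : ℝ≥0∞} (hXt : t ≤ μ X)
    (hYt : t ≤ μ Y) :
    ENNReal.ofReal ((a + b) ^ n) * t ≤ μ (a • X + b • Y) := by
  have hs : 0 < a + b := add_pos ha hb
  have hab : a / (a + b) + b / (a + b) = 1 := by field_simp
  have ha' : 0 < a / (a + b) := div_pos ha hs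
  have hb' : 0 < b / (a + b) := div_pos hb hs
  have hsum : a • X + b • Y = (a + b) • ((a / (a + b)) • X + (b / (a + b)) • Y) := by
    rw [smul_add, smul_smul, smul_smul, mul_div_cancel₀ _ hs.ne', mul_div_cancel₀ _ hs.ne']
  rw [hsum, Measure.addHaar_smul, finrank_euclideanSpace_fin, abs_of_pos (pow_pos hs n)]
  gcongr
  calc t = t ^ (a / (a + b)) * t ^ (b / (a + b)) := by
        rw [← ENNReal.rpow_add_of_nonneg _ _ ha'.le hb'.le, hab, ENNReal.rpow_one]
    _ ≤ μ X ^ (a / (a + b)) * μ Y ^ (b / (a + b)) := by gcongr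
    _ ≤ _ := addHaar_brunn_minkowski μ hX hY ha' hb' hab

theorem exists_linearIsometry_range_eq_inner_eq_zero {n : ℕ}
    {u : EuclideanSpace ℝ (Fin (n + 1))} (hu : u ≠ 0) :
    ∃ L : EuclideanSpace ℝ (Fin n) →ₗᵢ[ℝ] EuclideanSpace ℝ (Fin (n + 1)),
      range L = {x | ⟪x, u⟫ = 0} := by
  have : Fact (Module.finrank ℝ (EuclideanSpace ℝ (Fin (n + 1))) = n + 1) := ⟨by simp⟩
  let B := OrthonormalBasis.fromOrthogonalSpanSingleton (𝕜 := ℝ) n hu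
  refine ⟨(Submodule.subtypeₗᵢ _).comp B.repr.symm.toLinearIsometry, ?_⟩
  ext x
  simp only [mem_range, mem_ofPred_eq, ← Submodule.mem_orthogonal_singleton_iff_inner_left]
  constructor
  · rintro ⟨v, rfl⟩
    exact (B.repr.symm v).2
  · intro hx
    exact ⟨B.repr ⟨x, hx⟩, by simp⟩

theorem le_sectionVol_smul_add_smul {n : ℕ} {u : EuclideanSpace ℝ (Fin (n + 1))} (hu : ‖u‖ = 1)
    {A B : Set (EuclideanSpace ℝ (Fin (n + 1)))} (hA : IsCompact A) (hB : IsCompact B)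
    {α β : ℝ} (hα : 0 < α) (hβ : 0 < β) {t p q : ℝ}
    (hp : t ≤ sectionVol (n + 1) A u p) (hq : t ≤ sectionVol (n + 1) B u q) :
    (α + β) ^ n * t ≤ sectionVol (n + 1) (α • A + β • B) u (α * p + β * q) := by
  obtain ⟨L, hL⟩ := exists_linearIsometry_range_eq_inner_eq_zero (u := u)
    (norm_ne_zero_iff.1 (by simp [hu]))
  have huu : ⟪u, u⟫ = 1 := by rw [real_inner_self_eq_norm_sq, hu, one_pow]
  have hiso : ∀ r : ℝ, Isometry fun v => r • u + L v := fun r =>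
    (IsometryEquiv.constVAdd (r • u)).isometry.comp L.isometry
  have hrange : ∀ r : ℝ, range (fun v => r • u + L v) = {x | ⟪x, u⟫ = r} := by
    intro r
    ext x
    have hx : x - r • u ∈ range L ↔ ⟪x, u⟫ = r := by
      rw [hL, mem_ofPred_eq, inner_sub_left, real_inner_smul_left, huu, mul_one, sub_eq_zero]
    rw [mem_ofPred_eq, ← hx]
    simp only [mem_range, eq_sub_iff_add_eq, add_comm]
  have hvol : ∀ K r, sectionVol (n + 1) K u r = (μH[n] ((fun v => r • u + L v) ⁻¹' K)).toReal := by
    intro K r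
    rw [(hiso r).hausdorffMeasure_preimage (Or.inl n.cast_nonneg), hrange, sectionVol]
    simp
  have hcpt : ∀ K r, IsCompact K → IsCompact ((fun v => r • u + L v) ⁻¹' K) := fun K r hK =>
    (hiso r).isClosedEmbedding.isCompact_preimage hK
  have : (μH[n] : Measure (EuclideanSpace ℝ (Fin n))).IsAddHaarMeasure := by
    simpa using isAddHaarMeasure_hausdorffMeasure (E := EuclideanSpace ℝ (Fin n))
  rw [hvol] at hp hq ⊢
  refine (ENNReal.ofReal_le_iff_le_toReal
    (hcpt _ _ ((hA.smul α).add (hB.smul β))).measure_lt_top.ne).1 ?_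
  rw [ENNReal.ofReal_mul (by positivity)]
  refine (ofReal_add_pow_mul_le_addHaar μH[n] (hcpt A p hA) (hcpt B q hB) hα hβ
    (ENNReal.ofReal_le_of_le_toReal hp) (ENNReal.ofReal_le_of_le_toReal hq)).trans
    (measure_mono ?_)
  rintro _ ⟨_, ⟨v, hv, rfl⟩, _, ⟨w, hw, rfl⟩, rfl⟩
  refine ⟨_, smul_mem_smul_set hv, _, smul_mem_smul_set hw, ?_⟩
  simp only [smul_add, smul_smul, add_smul, map_add, map_smul]
  abel

theorem isBounded_setOf_le_sectionVol {d : ℕ} {u : EuclideanSpace ℝ (Fin d)}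
    {K : Set (EuclideanSpace ℝ (Fin d))} (hK : IsCompact K) {s : ℝ} (hs : 0 < s) :
    Bornology.IsBounded {p | s ≤ sectionVol d K u p} := by
  refine (hK.image (f := fun x => ⟪x, u⟫) (by fun_prop)).isBounded.subset fun p hp => ?_
  by_contra hpK
  have hempty : K ∩ {x | ⟪x, u⟫ = p} = ∅ :=
    eq_empty_of_forall_notMem fun x hx => hpK ⟨x, hx.1, hx.2⟩
  rw [mem_ofPred_eq, sectionVol, hempty, measure_empty, ENNReal.toReal_zero] at hp
  exact hp.not_gt hs

/-- With the maximal section volumes of `A` and `B` parallel to `L = u^⊥`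
normalized to `1` and `C = αA + βB`, the section-height functions satisfy
`c₊((α+β)^{d-1} t) ≥ α a₊(t) + β b₊(t)` and
`c₋((α+β)^{d-1} t) ≤ α a₋(t) + β b₋(t)` for `t ∈ (0,1]`. -/
theorem section_height_inequalities (d : ℕ) (hd : 2 ≤ d)
    (u : EuclideanSpace ℝ (Fin d)) (hu : ‖u‖ = 1)
    (A B : Set (EuclideanSpace ℝ (Fin d)))
    (hAc : IsCompact A) (hAcv : Convex ℝ A) (hAi : (interior A).Nonempty)
    (hBc : IsCompact B) (hBcv : Convex ℝ B) (hBi : (interior B).Nonempty)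
    (hMA : IsGreatest (Set.range (sectionVol d A u)) 1)
    (hMB : IsGreatest (Set.range (sectionVol d B u)) 1)
    (α β : ℝ) (hα : 0 < α) (hβ : 0 < β) :
    ∀ t ∈ Set.Ioc (0 : ℝ) 1,
      sSup {p | (α + β) ^ (d - 1) * t ≤ sectionVol d (α • A + β • B) u p} ≥
        α * sSup {p | t ≤ sectionVol d A u p} +
          β * sSup {p | t ≤ sectionVol d B u p} ∧
      sInf {p | (α + β) ^ (d - 1) * t ≤ sectionVol d (α • A + β • B) u p} ≤
        α * sInf {p | t ≤ sectionVol d A u p} +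
          β * sInf {p | t ≤ sectionVol d B u p} := by
  obtain ⟨n, rfl⟩ : ∃ n, d = n + 1 := ⟨d - 1, by omega⟩
  rintro t ⟨ht₀, ht₁⟩
  obtain ⟨p₀, hp₀⟩ := hMA.1
  obtain ⟨q₀, hq₀⟩ := hMB.1
  have hSA : {p | t ≤ sectionVol (n + 1) A u p}.Nonempty := ⟨p₀, ht₁.trans_eq hp₀.symm⟩
  have hSB : {p | t ≤ sectionVol (n + 1) B u p}.Nonempty := ⟨q₀, ht₁.trans_eq hq₀.symm⟩
  have hbA := isBounded_setOf_le_sectionVol (u := u) hAc ht₀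
  have hbB := isBounded_setOf_le_sectionVol (u := u) hBc ht₀
  have hbC := isBounded_setOf_le_sectionVol (u := u) ((hAc.smul α).add (hBc.smul β))
    (mul_pos (pow_pos (add_pos hα hβ) n) ht₀)
  have hsub : α • {p | t ≤ sectionVol (n + 1) A u p} + β • {p | t ≤ sectionVol (n + 1) B u p} ⊆
      {p | (α + β) ^ n * t ≤ sectionVol (n + 1) (α • A + β • B) u p} := by
    rintro _ ⟨_, ⟨p, hp, rfl⟩, _, ⟨q, hq, rfl⟩, rfl⟩
    exact le_sectionVol_smul_add_smul hu hAc hBc hα hβ hp hq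
  have hne := hSA.smul_set (a := α) |>.add (hSB.smul_set (a := β))
  rw [ge_iff_le, ← smul_eq_mul α, ← smul_eq_mul β, ← smul_eq_mul α, ← smul_eq_mul β,
    ← Real.sSup_smul_of_nonneg hα.le, ← Real.sSup_smul_of_nonneg hβ.le,
    ← Real.sInf_smul_of_nonneg hα.le, ← Real.sInf_smul_of_nonneg hβ.le,
    ← csSup_add hSA.smul_set (hbA.smul₀ α).bddAbove hSB.smul_set (hbB.smul₀ β).bddAbove,
    ← csInf_add hSA.smul_set (hbA.smul₀ α).bddBelow hSB.smul_set (hbB.smul₀ β).bddBelow]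
  exact ⟨csSup_le_csSup hbC.bddAbove hne hsub, csInf_le_csInf hbC.bddBelow hne hsub⟩
end
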